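/- arXiv:1307.2198 — 13 statements merged into one kernel-verified Lean document; each statement's English description precedes it below -/
import Mathlib

section
/- Let A be a real 4×4 matrix (indexed by {1,2,3,4}) whose entries have the following signs: A₁₁, A₁₂, A₁₃, A₁₄ > 0; A₂₁ > 0, A₂₂ < 0, A₂₃ > 0, A₂₄ < 0; A₃₁ > 0, A₃₂ > 0, A₃₃ < 0, A₃₄ < 0; A₄₁ > 0, A₄₂ < 0, A₄₃ < 0, A₄₄ > 0. If x ∈ ℝ⁴ satisfies Ax = 0 and x₁ = 0, then x = 0. -/
/-- A positive combination of three nonnegative reals vanishes only if each of them does. -/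
theorem eq_zero_of_pos_combination_eq_zero {p q r u v w : ℝ} (hp : 0 < p) (hq : 0 < q)
    (hr : 0 < r) (hu : 0 ≤ u) (hv : 0 ≤ v) (hw : 0 ≤ w) (h : p * u + q * v + r * w = 0) :
    u = 0 ∧ v = 0 ∧ w = 0 := by
  have h1 := mul_nonneg hp.le hu
  have h2 := mul_nonneg hq.le hv
  have h3 := mul_nonneg hr.le hw
  refine ⟨?_, ?_, ?_⟩
  · exact (mul_eq_zero.mp (by linarith : p * u = 0)).resolve_left hp.ne'
  · exact (mul_eq_zero.mp (by linarith : q * v = 0)).resolve_left hq.ne'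
  · exact (mul_eq_zero.mp (by linarith : r * w = 0)).resolve_left hr.ne'

/-- Signed zero forcing for the 4×4 Hadamard sign pattern: if `A` has the Hadamard
sign pattern, `A x = 0` and `x₁ = 0`, then `x = 0`. -/
theorem hadamard_pattern_forcing
    (A : Matrix (Fin 4) (Fin 4) ℝ)
    (h11 : 0 < A 0 0) (h12 : 0 < A 0 1) (h13 : 0 < A 0 2) (h14 : 0 < A 0 3)
    (h21 : 0 < A 1 0) (h22 : A 1 1 < 0) (h23 : 0 < A 1 2) (h24 : A 1 3 < 0)
    (h31 : 0 < A 2 0) (h32 : 0 < A 2 1) (h33 : A 2 2 < 0) (h34 : A 2 3 < 0)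
    (h41 : 0 < A 3 0) (h42 : A 3 1 < 0) (h43 : A 3 2 < 0) (h44 : 0 < A 3 3)
    (x : Fin 4 → ℝ) (hx : A.mulVec x = 0) (hx1 : x 0 = 0) :
    x = 0 := by
  have row (i : Fin 4) : A i 1 * x 1 + A i 2 * x 2 + A i 3 * x 3 = 0 := by
    simpa [Matrix.mulVec, dotProduct, Fin.sum_univ_four, hx1] using congrFun hx i
  suffices h : x 1 = 0 ∧ x 2 = 0 ∧ x 3 = 0 by
    ext i
    fin_cases i
    exacts [hx1, h.1, h.2.1, h.2.2]
  -- Up to a global sign, the signs of `x 1, x 2, x 3` agree with those of some row of `A`.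
  rcases le_total 0 (x 1) with h1 | h1 <;> rcases le_total 0 (x 2) with h2 | h2 <;>
    rcases le_total 0 (x 3) with h3 | h3
  · simpa using eq_zero_of_pos_combination_eq_zero h12 h13 h14
      h1 h2 h3 (by linarith [row 0])
  · simpa using eq_zero_of_pos_combination_eq_zero (neg_pos.mpr h42) (neg_pos.mpr h43) h44
      h1 h2 (neg_nonneg.mpr h3) (by linarith [row 3])
  · simpa using eq_zero_of_pos_combination_eq_zero (neg_pos.mpr h22) h23 (neg_pos.mpr h24)
      h1 (neg_nonneg.mpr h2) h3 (by linarith [row 1])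
  · simpa using eq_zero_of_pos_combination_eq_zero h32 (neg_pos.mpr h33) (neg_pos.mpr h34)
      h1 (neg_nonneg.mpr h2) (neg_nonneg.mpr h3) (by linarith [row 2])
  · simpa using eq_zero_of_pos_combination_eq_zero h32 (neg_pos.mpr h33) (neg_pos.mpr h34)
      (neg_nonneg.mpr h1) h2 h3 (by linarith [row 2])
  · simpa using eq_zero_of_pos_combination_eq_zero (neg_pos.mpr h22) h23 (neg_pos.mpr h24)
      (neg_nonneg.mpr h1) h2 (neg_nonneg.mpr h3) (by linarith [row 1])
  · simpa using eq_zero_of_pos_combination_eq_zero (neg_pos.mpr h42) (neg_pos.mpr h43) h44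
      (neg_nonneg.mpr h1) (neg_nonneg.mpr h2) h3 (by linarith [row 3])
  · simpa using eq_zero_of_pos_combination_eq_zero h12 h13 h14
      (neg_nonneg.mpr h1) (neg_nonneg.mpr h2) (neg_nonneg.mpr h3) (by linarith [row 0])
end

section
/- Every real 4×4 matrix A whose entries have the following signs — A₁₁, A₁₂, A₁₃, A₁₄ > 0; A₂₁ > 0, A₂₂ < 0, A₂₃ > 0, A₂₄ < 0; A₃₁ > 0, A₃₂ > 0, A₃₃ < 0, A₃₄ < 0; A₄₁ > 0, A₄₂ < 0, A₄₃ < 0, A₄₄ > 0 — has rank at least 3; equivalently, its nullity (the dimension of its kernel) is at most 1. -/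
theorem eq_zero_of_pos_combination_eq_zero_s1 {a b c x y z : ℝ} (hx : 0 < x) (hy : 0 < y) (hz : 0 < z)
    (h : a * x + b * y + c * z = 0) (ha : 0 ≤ a) (hb : 0 ≤ b) (hc : 0 ≤ c) :
    a = 0 ∧ b = 0 ∧ c = 0 := by
  have h1 := mul_nonneg ha hx.le
  have h2 := mul_nonneg hb hy.le
  have h3 := mul_nonneg hc hz.le
  exact ⟨(mul_eq_zero_iff_right hx.ne').1 (by linarith),
    (mul_eq_zero_iff_right hy.ne').1 (by linarith), (mul_eq_zero_iff_right hz.ne').1 (by linarith)⟩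

/-- The rows of a matrix with the first three rows of the Hadamard sign pattern are linearly
independent: up to a global sign, every sign vector of length three occurs among the columns. -/
theorem linearIndependent_of_sign_columns (M : Matrix (Fin 3) (Fin 4) ℝ)
    (h11 : 0 < M 0 0) (h12 : 0 < M 0 1) (h13 : 0 < M 0 2) (h14 : 0 < M 0 3)
    (h21 : 0 < M 1 0) (h22 : M 1 1 < 0) (h23 : 0 < M 1 2) (h24 : M 1 3 < 0)
    (h31 : 0 < M 2 0) (h32 : 0 < M 2 1) (h33 : M 2 2 < 0) (h34 : M 2 3 < 0) :
    LinearIndependent ℝ M.row := by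
  rw [Fintype.linearIndependent_iff]
  intro g hg
  have e (j : Fin 4) : g 0 * M 0 j + g 1 * M 1 j + g 2 * M 2 j = 0 := by
    simpa [Fin.sum_univ_three, Matrix.row] using congrFun hg j
  have key {a b c x y z : ℝ} (hx : 0 < x) (hy : 0 < y) (hz : 0 < z)
      (h : a * x + b * y + c * z = 0)
      (hs : (0 ≤ a ∧ 0 ≤ b ∧ 0 ≤ c) ∨ (a ≤ 0 ∧ b ≤ 0 ∧ c ≤ 0)) : a = 0 ∧ b = 0 ∧ c = 0 := by
    rcases hs with ⟨ha, hb, hc⟩ | ⟨ha, hb, hc⟩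
    · exact eq_zero_of_pos_combination_eq_zero_s1 hx hy hz h ha hb hc
    · simpa using eq_zero_of_pos_combination_eq_zero_s1 (a := -a) (b := -b) (c := -c) hx hy hz
        (by linarith) (neg_nonneg.2 ha) (neg_nonneg.2 hb) (neg_nonneg.2 hc)
  have k0 := key h11 h21 h31 (e 0)
  have k1 := key (a := g 0) (b := -g 1) (c := g 2) h12 (neg_pos.2 h22) h32 (by linarith [e 1])
  have k2 := key (a := g 0) (b := g 1) (c := -g 2) h13 h23 (neg_pos.2 h33) (by linarith [e 2])
  have k3 := key (a := g 0) (b := -g 1) (c := -g 2) h14 (neg_pos.2 h24) (neg_pos.2 h34)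
    (by linarith [e 3])
  simp only [neg_eq_zero, Left.nonneg_neg_iff, Left.neg_nonpos_iff] at k1 k2 k3
  have h0 : g 0 = 0 ∧ g 1 = 0 ∧ g 2 = 0 := by
    rcases le_total 0 (g 0) with h0 | h0 <;> rcases le_total 0 (g 1) with h1 | h1 <;>
      rcases le_total 0 (g 2) with h2 | h2 <;> simp only [h0, h1, h2, and_self, true_or, or_true,
        forall_const] at k0 k1 k2 k3 <;> assumption
  intro i
  fin_cases i
  exacts [h0.1, h0.2.1, h0.2.2]

/-- Every real matrix with the 4×4 Hadamard sign pattern has rank at least 3;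
equivalently, its nullity is at most 1. -/
theorem hadamard_pattern_rank_ge_three
    (A : Matrix (Fin 4) (Fin 4) ℝ)
    (h11 : 0 < A 0 0) (h12 : 0 < A 0 1) (h13 : 0 < A 0 2) (h14 : 0 < A 0 3)
    (h21 : 0 < A 1 0) (h22 : A 1 1 < 0) (h23 : 0 < A 1 2) (h24 : A 1 3 < 0)
    (h31 : 0 < A 2 0) (h32 : 0 < A 2 1) (h33 : A 2 2 < 0) (h34 : A 2 3 < 0)
    (h41 : 0 < A 3 0) (h42 : A 3 1 < 0) (h43 : A 3 2 < 0) (h44 : 0 < A 3 3) :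
    3 ≤ A.rank ∧ Module.finrank ℝ (LinearMap.ker A.mulVecLin) ≤ 1 := by
  have hli : LinearIndependent ℝ (A.submatrix (Fin.castSucc : Fin 3 → Fin 4) id).row :=
    linearIndependent_of_sign_columns _ h11 h12 h13 h14 h21 h22 h23 h24 h31 h32 h33 h34
  have hrank : 3 ≤ A.rank := by
    simpa [hli.rank_matrix] using A.rank_submatrix_le (Fin.castSucc : Fin 3 → Fin 4) id
  have hnull := A.mulVecLin.finrank_range_add_finrank_ker
  rw [Module.finrank_fin_fun] at hnull
  change A.rank + _ = 4 at hnull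
  exact ⟨hrank, by omega⟩
end

section
/- Every symmetric real matrix A in the class 𝒵 whose graph is the 3-dimensional hypercube Q₃ has nullity at most 3. -/
/-- A sum over the vertices of `Q₃`, grouped by the distance to the vertex `![a, b, c]`. -/
lemma sum_cube_eq (f : (Fin 3 → Bool) → ℝ) (a b c : Bool) :
    ∑ u, f u = f ![a, b, c] + f ![!a, b, c] + f ![a, !b, c] + f ![a, b, !c]
      + f ![a, !b, !c] + f ![!a, b, !c] + f ![!a, !b, c] + f ![!a, !b, !c] := by
  have h : (Finset.univ : Finset (Fin 3 → Bool)) =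
      {![a, b, c], ![!a, b, c], ![a, !b, c], ![a, b, !c],
        ![a, !b, !c], ![!a, b, !c], ![!a, !b, c], ![!a, !b, !c]} := by
    revert a b c; decide
  rw [h]
  repeat rw [Finset.sum_insert (by revert a b c; decide)]
  rw [Finset.sum_singleton]
  ring

/-- Row `![a, b, c]` of the equation `A x = 0` for a matrix whose graph is `Q₃`. -/
lemma cube_row_eq_zero {A : Matrix (Fin 3 → Bool) (Fin 3 → Bool) ℝ}
    (hgraph : ∀ u v, u ≠ v →
      (A u v ≠ 0 ↔ (Finset.univ.filter fun i => u i ≠ v i).card = 1))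
    {x : (Fin 3 → Bool) → ℝ} (hx : A.mulVec x = 0) (a b c : Bool) :
    A ![a, b, c] ![a, b, c] * x ![a, b, c] + A ![a, b, c] ![!a, b, c] * x ![!a, b, c]
      + A ![a, b, c] ![a, !b, c] * x ![a, !b, c]
      + A ![a, b, c] ![a, b, !c] * x ![a, b, !c] = 0 := by
  have key : ∀ u v : Fin 3 → Bool, u ≠ v →
      (Finset.univ.filter fun i => u i ≠ v i).card ≠ 1 → A u v = 0 := fun u v huv hc => by
    by_contra h
    exact hc ((hgraph u v huv).1 h)
  have z₁ : ∀ a b c, A ![a, b, c] ![a, !b, !c] = 0 := fun a b c =>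
    key _ _ (by revert a b c; decide) (by revert a b c; decide)
  have z₂ : ∀ a b c, A ![a, b, c] ![!a, b, !c] = 0 := fun a b c =>
    key _ _ (by revert a b c; decide) (by revert a b c; decide)
  have z₃ : ∀ a b c, A ![a, b, c] ![!a, !b, c] = 0 := fun a b c =>
    key _ _ (by revert a b c; decide) (by revert a b c; decide)
  have z₄ : ∀ a b c, A ![a, b, c] ![!a, !b, !c] = 0 := fun a b c =>
    key _ _ (by revert a b c; decide) (by revert a b c; decide)
  have h := congrFun hx ![a, b, c]
  simp only [Matrix.mulVec, dotProduct, Pi.zero_apply] at h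
  rw [sum_cube_eq _ a b c, z₁, z₂, z₃, z₄] at h
  linarith

/-- Restriction of the kernel vectors of `A` to the face of the cube with first coordinate
`false`. -/
def kerToFace (A : Matrix (Fin 3 → Bool) (Fin 3 → Bool) ℝ) :
    LinearMap.ker A.mulVecLin →ₗ[ℝ] (Bool × Bool → ℝ) where
  toFun x p := x.1 ![false, p.1, p.2]
  map_add' _ _ := rfl
  map_smul' _ _ := rfl

lemma kerToFace_injective {A : Matrix (Fin 3 → Bool) (Fin 3 → Bool) ℝ}
    (hgraph : ∀ u v, u ≠ v →
      (A u v ≠ 0 ↔ (Finset.univ.filter fun i => u i ≠ v i).card = 1)) :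
    Function.Injective (kerToFace A) := by
  rw [injective_iff_map_eq_zero]
  rintro ⟨x, hx⟩ h
  have hface : ∀ b c, x ![false, b, c] = 0 := fun b c => congrFun h (b, c)
  have hopp : ∀ b c, x ![true, b, c] = 0 := fun b c => by
    have hne : A ![false, b, c] ![true, b, c] ≠ 0 :=
      (hgraph _ _ (by revert b c; decide)).2 (by revert b c; decide)
    have hr := cube_row_eq_zero hgraph (x := x) (by simpa using hx) false b c
    simpa [hface, hne] using hr
  ext u
  have hu : u = ![u 0, u 1, u 2] := by
    ext i; fin_cases i <;> rfl
  change x u = 0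
  rw [hu]
  cases u 0
  · exact hface _ _
  · exact hopp _ _



/-- Every symmetric real matrix in the class 𝒵 whose graph is the 3-dimensional
hypercube `Q₃` has nullity at most 3. -/
theorem nullity_le_three_of_Z_matrix_graph_Q3
    (A : Matrix (Fin 3 → Bool) (Fin 3 → Bool) ℝ)
    (hsymm : A.IsSymm)
    (hZ : (∀ u v, u ≠ v → 0 ≤ A u v) ∨ (∀ u v, u ≠ v → A u v ≤ 0))
    (hgraph : ∀ u v, u ≠ v →
      (A u v ≠ 0 ↔ (Finset.univ.filter fun i => u i ≠ v i).card = 1)) :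
    Module.finrank ℝ (LinearMap.ker A.mulVecLin) ≤ 3 := by
  by_contra hlt
  have hinj := kerToFace_injective hgraph
  have hdim : Module.finrank ℝ (LinearMap.ker A.mulVecLin) =
      Module.finrank ℝ (Bool × Bool → ℝ) := by
    have hle := LinearMap.finrank_le_finrank_of_injective hinj
    simp only [Module.finrank_fintype_fun_eq_card, Fintype.card_prod, Fintype.card_bool] at hle ⊢
    omega
  obtain ⟨⟨x, hx⟩, hxe⟩ :=
    (LinearMap.injective_iff_surjective_of_finrank_eq_finrank hdim).1 hinj
      (Pi.single (true, true) 1)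
  have hface : ∀ b c, x ![false, b, c] =
      (Pi.single (true, true) 1 : Bool × Bool → ℝ) (b, c) := fun b c => congrFun hxe (b, c)
  have row := cube_row_eq_zero hgraph (x := x) (by simpa using hx)
  have edge : ∀ u v : Fin 3 → Bool, u ≠ v →
      (Finset.univ.filter fun i => u i ≠ v i).card = 1 → A u v ≠ 0 :=
    fun u v huv => (hgraph u v huv).2
  have e₀ := edge ![false, false, false] ![true, false, false] (by decide) (by decide)
  have e₁ := edge ![false, true, false] ![true, true, false] (by decide) (by decide)
  have e₂ := edge ![false, false, true] ![true, false, true] (by decide) (by decide)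
  have f₁ := edge ![false, true, false] ![false, true, true] (by decide) (by decide)
  have f₂ := edge ![false, false, true] ![false, true, true] (by decide) (by decide)
  have g₁ := edge ![true, false, false] ![true, true, false] (by decide) (by decide)
  have g₂ := edge ![true, false, false] ![true, false, true] (by decide) (by decide)
  have r₀ := row false false false
  have r₁ := row false true false
  have r₂ := row false false true
  have r₃ := row true false false
  simp [hface, e₀] at r₀ r₁ r₂ r₃
  simp only [r₀, mul_zero, zero_add] at r₃
  have neg : ∀ {p q y : ℝ}, 0 < p * q → p * y + q = 0 → y < 0 := fun {p q y} hpq h => by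
    by_contra! hy
    have hm : p * p * y + p * q = 0 := by linear_combination p * h
    linarith [mul_nonneg (mul_self_nonneg p) hy]
  have same : ∀ u v u' v' : Fin 3 → Bool, u ≠ v → u' ≠ v' → A u v ≠ 0 → A u' v' ≠ 0 →
      0 < A u v * A u' v' := fun u v u' v' h h' n n' => by
    rcases hZ with hZ | hZ
    · exact mul_pos ((hZ u v h).lt_of_ne' n) ((hZ u' v' h').lt_of_ne' n')
    · exact mul_pos_of_neg_of_neg ((hZ u v h).lt_of_ne n) ((hZ u' v' h').lt_of_ne n')
  have y₁ := neg (same _ _ _ _ (by decide) (by decide) e₁ f₁) r₁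
  have y₂ := neg (same _ _ _ _ (by decide) (by decide) e₂ f₂) r₂
  have hg := same _ _ _ _ (by decide) (by decide) g₁ g₂
  rcases mul_pos_iff.1 hg with ⟨h₁, h₂⟩ | ⟨h₁, h₂⟩
  · linarith [mul_neg_of_pos_of_neg h₁ y₁, mul_neg_of_pos_of_neg h₂ y₂]
  · linarith [mul_pos_of_neg_of_neg h₁ y₁, mul_pos_of_neg_of_neg h₂ y₂]
end

section
/- For every d ≥ 3, every symmetric real matrix A in the class 𝒵 whose graph is the d-dimensional hypercube Q_d has nullity at most 3·2^{d−3}. -/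
/-- The vertex of the hypercube `Q_(k+3)` with first coordinates `e`, `a`, `b` and
remaining coordinates `w`. -/
def cubeVertex {k : ℕ} (e a b : Bool) (w : Fin k → Bool) : Fin (k + 3) → Bool :=
  Fin.cons e (Fin.cons a (Fin.cons b w))

lemma exists_eq_cubeVertex {k : ℕ} (v : Fin (k + 3) → Bool) :
    ∃ e a b w, v = cubeVertex e a b w := by
  refine ⟨v 0, v 1, v 2, fun i => v i.succ.succ.succ, ?_⟩
  funext i
  refine Fin.cases rfl (fun i => ?_) i
  refine Fin.cases rfl (fun i => ?_) i
  exact Fin.cases rfl (fun i => rfl) i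

lemma cubeVertex_inj {k : ℕ} {e a b e' a' b' : Bool} {w w' : Fin k → Bool} :
    cubeVertex e a b w = cubeVertex e' a' b' w' ↔ e = e' ∧ a = a' ∧ b = b' ∧ w = w' := by
  simp [cubeVertex, Fin.cons_inj]

lemma card_filter_cubeVertex_ne {k : ℕ} (e a b e' a' b' : Bool) (w w' : Fin k → Bool) :
    (Finset.univ.filter fun i => cubeVertex e a b w i ≠ cubeVertex e' a' b' w' i).card =
      (if e ≠ e' then 1 else 0) + ((if a ≠ a' then 1 else 0) + ((if b ≠ b' then 1 else 0) +
        (Finset.univ.filter fun i => w i ≠ w' i).card)) := by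
  rw [Finset.card_filter, Finset.card_filter]
  simp only [Fin.sum_univ_succ, cubeVertex, Fin.cons_zero, Fin.cons_succ]

lemma card_filter_ne_eq_zero_iff {ι : Type*} [Fintype ι] (w w' : ι → Bool) :
    (Finset.univ.filter fun i => w i ≠ w' i).card = 0 ↔ w = w' := by
  simp [Finset.card_eq_zero, Finset.filter_eq_empty_iff, funext_iff]

lemma cubeVertex_neighbor_induction {k : ℕ} {P : (Fin (k + 3) → Bool) → Prop}
    {e a b : Bool} {w : Fin k → Bool}
    (h₁ : P (cubeVertex (!e) a b w)) (h₂ : P (cubeVertex e (!a) b w))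
    (h₃ : P (cubeVertex e a (!b) w)) (h₄ : ∀ w', P (cubeVertex e a b w'))
    {v : Fin (k + 3) → Bool}
    (hv : (Finset.univ.filter fun i => cubeVertex e a b w i ≠ v i).card = 1) : P v := by
  obtain ⟨e', a', b', w', rfl⟩ := exists_eq_cubeVertex v
  rw [card_filter_cubeVertex_ne] at hv
  have hw := card_filter_ne_eq_zero_iff w w'
  generalize (Finset.univ.filter fun i => w i ≠ w' i).card = n at hv hw
  by_cases he : e = e'
  · by_cases ha : a = a'
    · by_cases hb : b = b'
      · subst he ha hb
        exact h₄ w'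
      · rw [if_neg (not_not.2 he), if_neg (not_not.2 ha), if_pos hb] at hv
        obtain rfl := hw.1 (by omega)
        obtain rfl := Bool.eq_not_of_ne (Ne.symm hb)
        subst he ha
        exact h₃
    · rw [if_neg (not_not.2 he), if_pos ha] at hv
      obtain rfl := hw.1 (by omega)
      obtain rfl : b = b' := by
        by_contra hb
        rw [if_pos hb] at hv
        omega
      obtain rfl := Bool.eq_not_of_ne (Ne.symm ha)
      subst he
      exact h₂
  · rw [if_pos he] at hv
    obtain rfl := hw.1 (by omega)
    obtain rfl : b = b' := by
      by_contra hb
      rw [if_pos hb] at hv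
      omega
    obtain rfl : a = a' := by
      by_contra ha
      rw [if_pos ha] at hv
      omega
    obtain rfl := Bool.eq_not_of_ne (Ne.symm he)
    exact h₁

/-- If a row of `A` annihilates `x` and the row meets the support of `x` in at most the two
columns `p` and `q`, the corresponding two-term relation holds. -/
lemma Matrix.two_term_of_mulVec_eq_zero {ι : Type*} [Fintype ι] [DecidableEq ι]
    {A : Matrix ι ι ℝ} {x : ι → ℝ} (hx : A.mulVec x = 0) {u p q : ι} (hpq : p ≠ q)
    (h : ∀ v, v ≠ p → v ≠ q → A u v ≠ 0 → x v = 0) :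
    A u p * x p + A u q * x q = 0 := by
  have hu : ∑ v, A u v * x v = 0 := congrFun hx u
  rw [← Finset.sum_pair (f := fun v => A u v * x v) hpq, ← hu]
  refine Finset.sum_subset (Finset.subset_univ _) fun v _ hv => ?_
  simp only [Finset.mem_insert, Finset.mem_singleton, not_or] at hv
  by_cases hA : A u v = 0
  · simp [hA]
  · simp [h v hv.1 hv.2 hA]

lemma eq_zero_of_cyclic_relations {a b c d e f x y z : ℝ}
    (hsign : (0 < a ∧ 0 < b ∧ 0 < c ∧ 0 < d ∧ 0 < e ∧ 0 < f) ∨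
      (a < 0 ∧ b < 0 ∧ c < 0 ∧ d < 0 ∧ e < 0 ∧ f < 0))
    (h₁ : a * x + b * z = 0) (h₂ : c * y + d * z = 0) (h₃ : e * x + f * y = 0) : z = 0 := by
  have key : (e * c * b + f * a * d) * z = 0 := by
    linear_combination e * c * h₁ + f * a * h₂ - a * c * h₃
  refine (mul_eq_zero.mp key).resolve_left ?_
  rcases hsign with ⟨ha, hb, hc, hd, he, hf⟩ | ⟨ha, hb, hc, hd, he, hf⟩
  · positivity
  · exact (add_neg (mul_neg_of_pos_of_neg (mul_pos_of_neg_of_neg he hc) hb)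
      (mul_neg_of_pos_of_neg (mul_pos_of_neg_of_neg hf ha) hd)).ne

/-- A null vector of a Z-matrix of the hypercube vanishes as soon as it vanishes on the
vertices of one facet whose next two coordinates are not both `true`. -/
lemma eq_zero_of_vanishing_on_facet {k : ℕ}
    {A : Matrix (Fin (k + 3) → Bool) (Fin (k + 3) → Bool) ℝ}
    (hZ : (∀ u v, u ≠ v → 0 ≤ A u v) ∨ (∀ u v, u ≠ v → A u v ≤ 0))
    (hgraph : ∀ u v, u ≠ v →
      (A u v ≠ 0 ↔ (Finset.univ.filter fun i => u i ≠ v i).card = 1))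
    {x : (Fin (k + 3) → Bool) → ℝ} (hx : A.mulVec x = 0)
    (h₀ : ∀ a b w, (a && b) = false → x (cubeVertex false a b w) = 0) : x = 0 := by
  have adj : ∀ {u v}, u ≠ v →
      (Finset.univ.filter fun i => u i ≠ v i).card = 1 → A u v ≠ 0 :=
    fun h => (hgraph _ _ h).2
  have rel : ∀ {u p q}, p ≠ q → x u = 0 →
      (∀ v, (Finset.univ.filter fun i => u i ≠ v i).card = 1 → v ≠ p → v ≠ q → x v = 0) →
      A u p * x p + A u q * x q = 0 := by
    intro u p q hpq hu h
    refine Matrix.two_term_of_mulVec_eq_zero hx hpq fun v hp hq hA => ?_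
    by_cases huv : u = v
    · rwa [← huv]
    · exact h v ((hgraph u v huv).1 hA) hp hq
  have force : ∀ a b w, x (cubeVertex false a b w) = 0 →
      x (cubeVertex false (!a) b w) = 0 → x (cubeVertex false a (!b) w) = 0 →
      (∀ w', x (cubeVertex false a b w') = 0) → x (cubeVertex true a b w) = 0 := by
    intro a b w hu h₁ h₂ h₃
    have hne : cubeVertex true a b w ≠ cubeVertex false a b w := by simp [cubeVertex_inj]
    have := rel hne hu fun v hv => cubeVertex_neighbor_induction
      (P := fun v => v ≠ cubeVertex true a b w → v ≠ cubeVertex false a b w → x v = 0)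
      (fun h _ => absurd rfl h) (fun _ _ => h₁) (fun _ _ => h₂) (fun w' _ _ => h₃ w') hv
    rw [hu, mul_zero, add_zero] at this
    refine (mul_eq_zero.mp this).resolve_left (adj hne.symm ?_)
    rw [card_filter_cubeVertex_ne]
    simp
  have h₁ : ∀ w, x (cubeVertex true false false w) = 0 := fun w =>
    force _ _ _ (h₀ _ _ _ rfl) (h₀ _ _ _ rfl) (h₀ _ _ _ rfl) fun _ => h₀ _ _ _ rfl
  have h₂ : ∀ w, x (cubeVertex false true true w) = 0 := by
    intro w
    have n₁ : cubeVertex true true false w ≠ cubeVertex false true true w := by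
      simp [cubeVertex_inj]
    have n₂ : cubeVertex true false true w ≠ cubeVertex false true true w := by
      simp [cubeVertex_inj]
    have n₃ : cubeVertex true true false w ≠ cubeVertex true false true w := by
      simp [cubeVertex_inj]
    have r₁ := rel n₁ (h₀ true false w rfl) fun v hv => cubeVertex_neighbor_induction
      (P := fun v => v ≠ _ → v ≠ _ → x v = 0)
      (fun h _ => absurd rfl h) (fun _ _ => h₀ _ _ _ rfl) (fun _ h => absurd rfl h)
      (fun _ _ _ => h₀ _ _ _ rfl) hv
    have r₂ := rel n₂ (h₀ false true w rfl) fun v hv => cubeVertex_neighbor_induction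
      (P := fun v => v ≠ _ → v ≠ _ → x v = 0)
      (fun h _ => absurd rfl h) (fun _ h => absurd rfl h) (fun _ _ => h₀ _ _ _ rfl)
      (fun _ _ _ => h₀ _ _ _ rfl) hv
    have r₃ := rel n₃ (h₁ w) fun v hv => cubeVertex_neighbor_induction
      (e := true) (P := fun v => v ≠ _ → v ≠ _ → x v = 0)
      (fun _ _ => h₀ false false w rfl) (fun h _ => absurd rfl h) (fun _ h => absurd rfl h)
      (fun w' _ _ => h₁ w') hv
    refine eq_zero_of_cyclic_relations ?_ r₁ r₂ r₃
    have edge : ∀ {e a b e' a' b'}, (if e ≠ e' then 1 else 0) +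
        ((if a ≠ a' then 1 else 0) + ((if b ≠ b' then 1 else 0) + 0)) = 1 →
        cubeVertex e a b w ≠ cubeVertex e' a' b' w ∧
        A (cubeVertex e a b w) (cubeVertex e' a' b' w) ≠ 0 := by
      intro e a b e' a' b' h
      have hne : cubeVertex e a b w ≠ cubeVertex e' a' b' w := by
        intro heq
        obtain ⟨rfl, rfl, rfl, -⟩ := cubeVertex_inj.1 heq
        simp at h
      refine ⟨hne, adj hne ?_⟩
      rw [card_filter_cubeVertex_ne, (card_filter_ne_eq_zero_iff w w).2 rfl]
      exact h
    rcases hZ with hZ | hZ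
    · left
      refine ⟨?_, ?_, ?_, ?_, ?_, ?_⟩ <;>
      exact lt_of_le_of_ne (hZ _ _ (edge rfl).1) (edge rfl).2.symm
    · right
      refine ⟨?_, ?_, ?_, ?_, ?_, ?_⟩ <;>
      exact lt_of_le_of_ne (hZ _ _ (edge rfl).1) (edge rfl).2
  have h₃ : ∀ a b w, x (cubeVertex false a b w) = 0 := by
    intro a b w
    cases hab : (a && b)
    · exact h₀ a b w hab
    · obtain ⟨rfl, rfl⟩ := Bool.and_eq_true_iff.mp hab
      exact h₂ w
  funext v
  obtain ⟨e, a, b, w, rfl⟩ := exists_eq_cubeVertex v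
  cases e
  · exact h₃ a b w
  · exact force a b w (h₃ _ _ _) (h₃ _ _ _) (h₃ _ _ _) fun _ => h₃ _ _ _

/-- For every `d ≥ 3`, every symmetric real matrix in the class 𝒵 whose graph is
the `d`-dimensional hypercube `Q_d` has nullity at most `3 · 2^(d-3)`. -/
theorem nullity_le_of_Z_matrix_graph_hypercube
    (d : ℕ) (hd : 3 ≤ d)
    (A : Matrix (Fin d → Bool) (Fin d → Bool) ℝ)
    (hsymm : A.IsSymm)
    (hZ : (∀ u v, u ≠ v → 0 ≤ A u v) ∨ (∀ u v, u ≠ v → A u v ≤ 0))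
    (hgraph : ∀ u v, u ≠ v →
      (A u v ≠ 0 ↔ (Finset.univ.filter fun i => u i ≠ v i).card = 1)) :
    Module.finrank ℝ (LinearMap.ker A.mulVecLin) ≤ 3 * 2 ^ (d - 3) := by
  obtain ⟨k, rfl⟩ := Nat.exists_eq_add_of_le' hd
  let restrict : ((Fin (k + 3) → Bool) → ℝ) →ₗ[ℝ]
      ({p : Bool × Bool // (p.1 && p.2) = false} × (Fin k → Bool) → ℝ) :=
    LinearMap.funLeft ℝ ℝ fun s => cubeVertex false s.1.1.1 s.1.1.2 s.2
  have hinj : Function.Injective (restrict.comp (LinearMap.ker A.mulVecLin).subtype) := by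
    refine (injective_iff_map_eq_zero _).2 fun x hx => Subtype.ext ?_
    exact eq_zero_of_vanishing_on_facet hZ hgraph x.2 fun a b w hab =>
      congrFun hx (⟨(a, b), hab⟩, w)
  refine (LinearMap.finrank_le_finrank_of_injective hinj).trans_eq ?_
  have hcard : Fintype.card {p : Bool × Bool // (p.1 && p.2) = false} = 3 := by decide
  rw [Module.finrank_fintype_fun_eq_card, Fintype.card_prod, hcard]
  simp
end

section
/- Let G be a simple graph on a finite vertex set V and let C₁, …, C_m be an edge clique cover of G. Define the real matrix A indexed by V by A_{uv} = the number of indices i with u ∈ C_i and v ∈ C_i (i.e., A = Σᵢ vᵢ vᵢᵀ where vᵢ is the 0/1 indicator vector of C_i). Then A is symmetric positive semidefinite with nonnegative entries, the graph of A is G (for u ≠ v, A_{uv} ≠ 0 if and only if u and v are adjacent in G), and the rank of A is at most m. -/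
/-- The vertex-by-block incidence matrix of a finite family of finsets. -/
def incidenceOfFamily {V ι : Type*} [DecidableEq V] (C : ι → Finset V) : Matrix V ι ℝ :=
  Matrix.of fun v i => if v ∈ C i then 1 else 0

theorem incidenceOfFamily_mul_conjTranspose_apply {V ι : Type*} [DecidableEq V] [Fintype ι]
    (C : ι → Finset V) (u v : V) :
    (incidenceOfFamily C * (incidenceOfFamily C).conjTranspose) u v =
      ((Finset.univ.filter fun i => u ∈ C i ∧ v ∈ C i).card : ℝ) := by
  simp [incidenceOfFamily, Matrix.mul_apply, ← ite_and, and_comm]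

/-- If `C₁, …, C_m` is an edge clique cover of a simple graph `G`, then the
matrix `A` with `A u v = #{i | u ∈ Cᵢ ∧ v ∈ Cᵢ}` (i.e. `A = Σᵢ vᵢ vᵢᵀ`) is a
symmetric positive semidefinite matrix with nonnegative entries whose graph is
`G` and whose rank is at most `m`. -/
theorem cliqueCover_matrix_properties
    {V : Type*} [Fintype V] [DecidableEq V]
    (G : SimpleGraph V) (m : ℕ) (C : Fin m → Finset V)
    (hclique : ∀ i, G.IsClique (C i : Set V))
    (hcover : ∀ u v, G.Adj u v → ∃ i, u ∈ C i ∧ v ∈ C i)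
    (A : Matrix V V ℝ)
    (hA : ∀ u v, A u v = ((Finset.univ.filter fun i => u ∈ C i ∧ v ∈ C i).card : ℝ)) :
    A.IsSymm ∧ A.PosSemidef ∧ (∀ u v, 0 ≤ A u v) ∧
      (∀ u v, u ≠ v → (A u v ≠ 0 ↔ G.Adj u v)) ∧ A.rank ≤ m := by
  have hB : A = incidenceOfFamily C * (incidenceOfFamily C).conjTranspose := by
    ext u v
    rw [hA, incidenceOfFamily_mul_conjTranspose_apply]
  refine ⟨?_, ?_, fun u v => ?_, fun u v huv => ?_, ?_⟩
  · ext u v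
    simp only [Matrix.transpose_apply, hA, and_comm]
  · rw [hB]
    exact Matrix.posSemidef_self_mul_conjTranspose _
  · rw [hA]
    positivity
  · rw [hA, Nat.cast_ne_zero, Finset.card_ne_zero]
    constructor
    · rintro ⟨i, hi⟩
      obtain ⟨hu, hv⟩ := (Finset.mem_filter.mp hi).2
      exact hclique i hu hv huv
    · intro h
      obtain ⟨i, hi⟩ := hcover u v h
      exact ⟨i, by simpa using hi⟩
  · rw [hB]
    calc (incidenceOfFamily C * (incidenceOfFamily C).conjTranspose).rank
        ≤ (incidenceOfFamily C).rank := Matrix.rank_mul_le_left _ _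
      _ ≤ Fintype.card (Fin m) := Matrix.rank_le_card_width _
      _ = m := Fintype.card_fin m
end

section
/- Let G be a simple graph on n vertices admitting an edge clique cover C₁, …, C_m. Then there exists a symmetric real matrix A with all entries nonnegative (hence A belongs to the class 𝒵) whose graph is G and whose nullity is at least n − m. In particular, the maximum nullity of a matrix in 𝒵 whose graph is G is at least n − cc(G), where cc(G) is the minimum size of an edge clique cover of G. -/
/-- The clique-cover number of a simple graph: the minimum number of cliques
needed to cover all edges. -/
noncomputable def cliqueCoverNumber {V : Type*} [Fintype V] (G : SimpleGraph V) : ℕ :=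
  sInf {m : ℕ | ∃ C : Fin m → Finset V,
    (∀ i, G.IsClique (C i : Set V)) ∧ ∀ u v, G.Adj u v → ∃ i, u ∈ C i ∧ v ∈ C i}

/-- The Gram matrix of the vertex-clique incidence matrix of an edge clique cover by `m` cliques
is symmetric, entrywise nonnegative, has graph `G`, and has nullity at least `n - m`. -/
theorem exists_nonneg_matrix_nullity_of_edgeCliqueCover
    {V : Type*} [Fintype V] [DecidableEq V]
    (G : SimpleGraph V) (m : ℕ) (C : Fin m → Finset V)
    (hclique : ∀ i, G.IsClique (C i : Set V))
    (hcover : ∀ u v, G.Adj u v → ∃ i, u ∈ C i ∧ v ∈ C i) :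
    ∃ A : Matrix V V ℝ, A.IsSymm ∧ (∀ u v, 0 ≤ A u v) ∧
      (∀ u v, u ≠ v → (A u v ≠ 0 ↔ G.Adj u v)) ∧
      Fintype.card V - m ≤ Module.finrank ℝ (LinearMap.ker A.mulVecLin) := by
  let B : Matrix V (Fin m) ℝ := Matrix.of fun v i => if v ∈ C i then 1 else 0
  have hB : ∀ u v i, 0 ≤ B u i * B.transpose i v := fun u v i => by
    simp only [B, Matrix.transpose_apply, Matrix.of_apply]
    split_ifs <;> norm_num
  refine ⟨B * B.transpose, by simp [Matrix.IsSymm, Matrix.transpose_mul],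
    fun u v => ?_, fun u v huv => ?_, ?_⟩
  · rw [Matrix.mul_apply]
    exact Finset.sum_nonneg fun i _ => hB u v i
  · rw [Matrix.mul_apply, Ne, Finset.sum_eq_zero_iff_of_nonneg fun i _ => hB u v i]
    simp only [B, Finset.mem_univ, forall_const, Matrix.transpose_apply, Matrix.of_apply,
      mul_ite, mul_one, mul_zero, ite_eq_right_iff, one_ne_zero, imp_false, not_forall, not_not,
      exists_prop]
    exact ⟨fun ⟨i, hv, hu⟩ => hclique i hu hv huv,
      fun h => (hcover u v h).imp fun i hi => hi.symm⟩
  · have hrank : (B * B.transpose).rank ≤ m :=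
      (Matrix.rank_mul_le_left B _).trans (by simpa using B.rank_le_card_width)
    have hsum := LinearMap.finrank_range_add_finrank_ker (B * B.transpose).mulVecLin
    rw [Module.finrank_pi] at hsum
    rw [Matrix.rank] at hrank
    omega

/-- If a graph `G` on `n` vertices has an edge clique cover `C₁, …, C_m`, then
there is a symmetric entrywise-nonnegative real matrix (hence a matrix in the
class 𝒵) whose graph is `G` and whose nullity is at least `n − m`; in
particular there is one of nullity at least `n − cc(G)`. -/
theorem exists_Z_matrix_nullity_ge_card_sub_cliqueCover
    {V : Type*} [Fintype V] [DecidableEq V]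
    (G : SimpleGraph V) (m : ℕ) (C : Fin m → Finset V)
    (hclique : ∀ i, G.IsClique (C i : Set V))
    (hcover : ∀ u v, G.Adj u v → ∃ i, u ∈ C i ∧ v ∈ C i) :
    (∃ A : Matrix V V ℝ, A.IsSymm ∧ (∀ u v, 0 ≤ A u v) ∧
        (∀ u v, u ≠ v → (A u v ≠ 0 ↔ G.Adj u v)) ∧
        Fintype.card V - m ≤ Module.finrank ℝ (LinearMap.ker A.mulVecLin)) ∧
      ∃ A : Matrix V V ℝ, A.IsSymm ∧ (∀ u v, 0 ≤ A u v) ∧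
        (∀ u v, u ≠ v → (A u v ≠ 0 ↔ G.Adj u v)) ∧
        Fintype.card V - cliqueCoverNumber G ≤
          Module.finrank ℝ (LinearMap.ker A.mulVecLin) := by
  refine ⟨exists_nonneg_matrix_nullity_of_edgeCliqueCover G m C hclique hcover, ?_⟩
  obtain ⟨D, hD, hD'⟩ := Nat.sInf_mem
    (s := {m : ℕ | ∃ C : Fin m → Finset V,
      (∀ i, G.IsClique (C i : Set V)) ∧ ∀ u v, G.Adj u v → ∃ i, u ∈ C i ∧ v ∈ C i})
    ⟨m, C, hclique, hcover⟩
  exact exists_nonneg_matrix_nullity_of_edgeCliqueCover G (cliqueCoverNumber G) D hD hD'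
end

section
/- For every n ≥ 3, there exists a symmetric real matrix A with all entries nonnegative (hence A belongs to the class 𝒵) whose graph is L(K_n), the line graph of the complete graph on n vertices, and whose nullity is at least C(n,2) − n (where C(n,2) = n(n−1)/2 is the number of vertices of L(K_n)). -/
/-- The nullity of a product `B * C` is at least the number of columns of `C` minus the size of the
inner index type. -/
theorem card_sub_card_le_finrank_ker_mul {m n k K : Type*} [Fintype m] [Fintype n] [Fintype k]
    [Field K] (B : Matrix m k K) (C : Matrix k n K) :
    Fintype.card n - Fintype.card k ≤ Module.finrank K (LinearMap.ker (B * C).mulVecLin) := by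
  have h := LinearMap.finrank_range_add_finrank_ker (B * C).mulVecLin
  have hr : (B * C).rank ≤ Fintype.card k :=
    (Matrix.rank_mul_le_left B C).trans (Matrix.rank_le_card_width B)
  rw [Module.finrank_fintype_fun_eq_card] at h
  unfold Matrix.rank at hr
  omega

/-- For every `n ≥ 3` there is a symmetric entrywise-nonnegative real matrix
(hence a matrix in the class 𝒵) whose graph is `L(K_n)` and whose nullity is at
least `C(n,2) − n`. -/
theorem exists_Z_matrix_lineGraph_clique_nullity_ge
    (n : ℕ) (hn : 3 ≤ n) :
    ∃ A : Matrix {e : Finset (Fin n) // e.card = 2} {e : Finset (Fin n) // e.card = 2} ℝ,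
      A.IsSymm ∧ (∀ e f, 0 ≤ A e f) ∧
      (∀ e f, e ≠ f → (A e f ≠ 0 ↔ ((e : Finset (Fin n)) ∩ (f : Finset (Fin n))).Nonempty)) ∧
      n.choose 2 - n ≤ Module.finrank ℝ (LinearMap.ker A.mulVecLin) := by
  let N : Matrix {e : Finset (Fin n) // e.card = 2} (Fin n) ℝ :=
    Matrix.of fun e i => if i ∈ e.1 then 1 else 0
  have hN : ∀ e f, (N * N.transpose) e f = ((e.1 ∩ f.1).card : ℝ) := by
    intro e f
    simp [N, Matrix.mul_apply, ← ite_and]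
    congr 1
    ext x
    simp [and_comm]
  refine ⟨N * N.transpose, Matrix.IsSymm.ext fun e f => ?_, fun e f => ?_, fun e f _ => ?_, ?_⟩
  · rw [hN, hN, Finset.inter_comm]
  · rw [hN]
    positivity
  · rw [hN, Nat.cast_ne_zero, Finset.card_ne_zero]
  · have h := card_sub_card_le_finrank_ker_mul N N.transpose
    rwa [Fintype.card_finset_len, Fintype.card_fin] at h
end

section
/- Let n ≥ 6 and let A be a symmetric real matrix in the class 𝒵, indexed by the 2-element subsets of {1, …, n}, whose graph is L(K_n) (i.e., for distinct 2-element subsets e, f one has A e f ≠ 0 if and only if e ∩ f ≠ ∅). Let S be the set of all 2-element subsets of {1, …, n} except for the pairs {i, n} with 1 ≤ i ≤ n−3 and the three pairs {n−2, n−1}, {n−2, n}, {n−1, n}. If x is a real vector indexed by the 2-element subsets of {1, …, n} with A x = 0 and x_e = 0 for every e ∈ S, then x = 0. -/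
theorem finset_pair_eq_pair_iff {α : Type*} [DecidableEq α] {x y z w : α} :
    ({x, y} : Finset α) = {z, w} ↔ x = z ∧ y = w ∨ x = w ∧ y = z := by
  rw [← Finset.coe_inj]
  push_cast
  exact Set.pair_eq_pair_iff

/-- If row `e` of a matrix with off-diagonal entries of a common sign annihilates `x`, and the row
meets the support of `x` only in `f` and `g`, then `x f` and `x g` have opposite signs. -/
theorem sign_eq_neg_sign_of_mulVec_eq_zero {V : Type*} [Fintype V] [DecidableEq V]
    {A : Matrix V V ℝ}
    (hZ : (∀ e f, e ≠ f → 0 ≤ A e f) ∨ (∀ e f, e ≠ f → A e f ≤ 0))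
    {x : V → ℝ} (hx : A.mulVec x = 0) {e f g : V} (hfg : f ≠ g) (hef : e ≠ f) (heg : e ≠ g)
    (hf : A e f ≠ 0) (hg : A e g ≠ 0) (hzero : ∀ h, x h ≠ 0 → A e h ≠ 0 → h = f ∨ h = g) :
    SignType.sign (x f) = -SignType.sign (x g) := by
  have hrow : A e f * x f + A e g * x g = 0 := by
    have h := congrFun hx e
    simp only [Matrix.mulVec, dotProduct, Pi.zero_apply] at h
    rw [← h, ← Finset.sum_pair (f := fun v => A e v * x v) hfg]
    refine Finset.sum_subset (Finset.subset_univ _) fun v _ hv => ?_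
    by_contra hne
    obtain ⟨hA, hxv⟩ := mul_ne_zero_iff.mp hne
    exact hv (by simpa using hzero v hxv hA)
  have hsign : SignType.sign (A e f) = SignType.sign (A e g) := by
    rcases hZ with hZ | hZ
    · rw [sign_pos ((hZ e f hef).lt_of_ne' hf), sign_pos ((hZ e g heg).lt_of_ne' hg)]
    · rw [sign_neg ((hZ e f hef).lt_of_ne hf), sign_neg ((hZ e g heg).lt_of_ne hg)]
  have h := congrArg SignType.sign (eq_neg_of_add_eq_zero_left hrow)
  rw [Left.sign_neg, sign_mul, sign_mul, hsign] at h
  have hne : SignType.sign (A e g) ≠ 0 := sign_ne_zero.mpr hg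
  revert h hne
  generalize SignType.sign (A e g) = s
  generalize SignType.sign (x f) = t
  generalize SignType.sign (x g) = u
  revert s t u
  decide

/-- Three reals with pairwise opposite signs all vanish. -/
theorem eq_zero_of_pairwise_opposite_sign {a b c : ℝ}
    (hab : SignType.sign a = -SignType.sign b) (hac : SignType.sign a = -SignType.sign c)
    (hbc : SignType.sign b = -SignType.sign c) : a = 0 ∧ b = 0 ∧ c = 0 := by
  rw [← sign_eq_zero_iff (a := a), ← sign_eq_zero_iff (a := b), ← sign_eq_zero_iff (a := c)]
  revert hab hac hbc
  generalize SignType.sign a = s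
  generalize SignType.sign b = t
  generalize SignType.sign c = u
  revert s t u
  decide

/-- A vector in the kernel of a `𝒵`-matrix with graph `L(K_n)`, supported on the edges at a vertex
`c` together with one further edge `{a, b}`, vanishes. -/
theorem eq_zero_of_support_subset_star_union_edge {n : ℕ}
    {A : Matrix {e : Finset (Fin n) // e.card = 2} {e : Finset (Fin n) // e.card = 2} ℝ}
    (hZ : (∀ e f, e ≠ f → 0 ≤ A e f) ∨ (∀ e f, e ≠ f → A e f ≤ 0))
    (hgraph : ∀ e f, e ≠ f →
      (A e f ≠ 0 ↔ ((e : Finset (Fin n)) ∩ (f : Finset (Fin n))).Nonempty))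
    {x : {e : Finset (Fin n) // e.card = 2} → ℝ} (hx : A.mulVec x = 0)
    {a b c : Fin n} (hab : a ≠ b) (hac : a ≠ c) (hbc : b ≠ c)
    (hn : 6 ≤ n)
    (hsupp : ∀ e, x e ≠ 0 → c ∈ e.1 ∨ e.1 = {a, b}) : x = 0 := by
  have hopp : ∀ e f g : {e : Finset (Fin n) // e.card = 2}, x e = 0 → f ≠ g → e ≠ f → e ≠ g →
      (e.1 ∩ f.1).Nonempty → (e.1 ∩ g.1).Nonempty →
      (∀ h, x h ≠ 0 → (e.1 ∩ h.1).Nonempty → h.1 = f.1 ∨ h.1 = g.1) →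
      SignType.sign (x f) = -SignType.sign (x g) := by
    intro e f g he hfg hef heg hf hg hh
    refine sign_eq_neg_sign_of_mulVec_eq_zero hZ hx hfg hef heg ((hgraph _ _ hef).mpr hf)
      ((hgraph _ _ heg).mpr hg) fun h hxh hAh => ?_
    have heh : e ≠ h := by rintro rfl; exact hxh he
    simpa only [Subtype.ext_iff] using hh h hxh ((hgraph _ _ heh).mp hAh)
  have hform : ∀ e : {e : Finset (Fin n) // e.card = 2}, c ∈ e.1 → ∃ i, i ≠ c ∧ e.1 = {i, c} := by
    rintro ⟨e, he⟩ hce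
    obtain ⟨u, v, huv, rfl⟩ := Finset.card_eq_two.mp he
    simp only [Finset.mem_insert, Finset.mem_singleton] at hce
    rcases hce with rfl | rfl
    · exact ⟨v, huv.symm, Finset.pair_comm _ _⟩
    · exact ⟨u, huv, rfl⟩
  have houter : ∀ i j (hij : i ≠ j) (hi : i ≠ c) (hj : j ≠ c), i ≠ a → i ≠ b → j ≠ a → j ≠ b →
      SignType.sign (x ⟨{i, c}, Finset.card_pair hi⟩) =
        -SignType.sign (x ⟨{j, c}, Finset.card_pair hj⟩) := by
    intro i j hij hi hj hia hib hja hjb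
    refine hopp ⟨{i, j}, Finset.card_pair hij⟩ _ _ ?_ ?_ ?_ ?_ ?_ ?_ ?_
    · by_contra hne
      have := hsupp _ hne
      simp only [Finset.mem_insert, Finset.mem_singleton, finset_pair_eq_pair_iff] at this
      grind
    · rw [ne_eq, Subtype.mk_eq_mk, finset_pair_eq_pair_iff]; grind
    · rw [ne_eq, Subtype.mk_eq_mk, finset_pair_eq_pair_iff]; grind
    · rw [ne_eq, Subtype.mk_eq_mk, finset_pair_eq_pair_iff]; grind
    · exact ⟨i, by simp⟩
    · exact ⟨j, by simp⟩
    · rintro h hxh ⟨k, hk⟩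
      rcases hsupp h hxh with hc | hh
      · obtain ⟨m, hm, hh⟩ := hform h hc
        simp [hh] at hk ⊢
        grind
      · simp [hh] at hk
        grind
  have hex : ∀ s : Finset (Fin n), s.card ≤ 5 → ∃ i, i ∉ s := fun s hs => by
    obtain ⟨i, -, hi⟩ := Finset.exists_mem_notMem_of_card_lt_card
      (s := s) (t := Finset.univ) (by simp; omega)
    exact ⟨i, hi⟩
  have hstar : ∀ i (hi : i ≠ c), i ≠ a → i ≠ b → x ⟨{i, c}, Finset.card_pair hi⟩ = 0 := by
    intro i hi hia hib
    obtain ⟨j, hj⟩ := hex {a, b, c, i} (Finset.card_le_four.trans (by norm_num))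
    obtain ⟨k, hk⟩ := hex {a, b, c, i, j} Finset.card_le_five
    simp only [Finset.mem_insert, Finset.mem_singleton, not_or] at hj hk
    obtain ⟨hja, hjb, hjc, hji⟩ := hj
    obtain ⟨hka, hkb, hkc, hki, hkj⟩ := hk
    exact (eq_zero_of_pairwise_opposite_sign
      (houter i j (Ne.symm hji) hi hjc hia hib hja hjb)
      (houter i k (Ne.symm hki) hi hkc hia hib hka hkb)
      (houter j k (Ne.symm hkj) hjc hkc hja hjb hka hkb)).1
  have htriangle : ∀ e, x e ≠ 0 → e.1 = {a, c} ∨ e.1 = {b, c} ∨ e.1 = {a, b} := by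
    intro e hxe
    rcases hsupp e hxe with hc | he
    · obtain ⟨i, hi, he⟩ := hform e hc
      by_contra! hne
      refine hxe ?_
      have hia : i ≠ a := by rintro rfl; exact hne.1 he
      have hib : i ≠ b := by rintro rfl; exact hne.2.1 he
      rw [← hstar i hi hia hib]
      exact congrArg x (Subtype.ext he)
    · exact Or.inr (Or.inr he)
  obtain ⟨i, hi⟩ := hex {a, b, c} (Finset.card_le_three.trans (by norm_num))
  simp only [Finset.mem_insert, Finset.mem_singleton, not_or] at hi
  obtain ⟨hia, hib, hic⟩ := hi
  have hpendant : ∀ u v w (hvu : v ≠ u) (hwu : w ≠ u) (hiu : i ≠ u), v ≠ w → i ≠ v → i ≠ w →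
      (∀ e, x e ≠ 0 → e.1 = {v, u} ∨ e.1 = {w, u} ∨ e.1 = {v, w}) →
      SignType.sign (x ⟨{v, u}, Finset.card_pair hvu⟩) =
        -SignType.sign (x ⟨{w, u}, Finset.card_pair hwu⟩) := by
    intro u v w hvu hwu hiu hvw hiv hiw hs
    refine hopp ⟨{i, u}, Finset.card_pair hiu⟩ _ _ ?_ ?_ ?_ ?_ ?_ ?_ ?_
    · by_contra hne
      have := hs _ hne
      simp only [finset_pair_eq_pair_iff] at this
      grind
    · rw [ne_eq, Subtype.mk_eq_mk, finset_pair_eq_pair_iff]; grind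
    · rw [ne_eq, Subtype.mk_eq_mk, finset_pair_eq_pair_iff]; grind
    · rw [ne_eq, Subtype.mk_eq_mk, finset_pair_eq_pair_iff]; grind
    · exact ⟨u, by simp⟩
    · exact ⟨u, by simp⟩
    · rintro h hxh ⟨k, hk⟩
      rcases hs h hxh with hh | hh | hh
      · exact Or.inl hh
      · exact Or.inr hh
      · simp [hh] at hk
        grind
  have h1 := hpendant c a b hac hbc hic hab hia hib htriangle
  have h2 := hpendant a c b hac.symm hab.symm hia hbc.symm hic hib fun e he => by
    have := htriangle e he
    rw [Finset.pair_comm c a, Finset.pair_comm b a, Finset.pair_comm c b]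
    tauto
  have h3 := hpendant b c a hbc.symm hab hib hac.symm hic hia fun e he => by
    have := htriangle e he
    rw [Finset.pair_comm c b, Finset.pair_comm c a]
    tauto
  simp only [Finset.pair_comm c a, Finset.pair_comm b a, Finset.pair_comm c b] at h2 h3
  obtain ⟨hxac, hxbc, hxab⟩ := eq_zero_of_pairwise_opposite_sign h1 h2 h3
  funext e
  by_contra hne
  rcases htriangle e hne with he | he | he
  · exact hne ((congrArg x (Subtype.ext he)).trans hxac)
  · exact hne ((congrArg x (Subtype.ext he)).trans hxbc)
  · exact hne ((congrArg x (Subtype.ext he)).trans hxab)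


/-- Signed zero forcing for `L(K_n)`, `n ≥ 6`. Vertices are 2-element subsets of
`Fin n`, where the element `k : Fin n` represents the label `k+1 ∈ {1, …, n}`.
`S` consists of all pairs except the pairs `{i, n}` with `1 ≤ i ≤ n−3` (i.e.
`{j, n−1}` in 0-indexed form with `j+1 ≤ n−3`) and the three pairs
`{n−2, n−1}, {n−2, n}, {n−1, n}`. If `A` is a symmetric 𝒵-matrix whose graph is
`L(K_n)`, `A x = 0`, and `x` vanishes on `S`, then `x = 0`. -/
theorem lineGraph_clique_forcing
    (n : ℕ) (hn : 6 ≤ n)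
    (A : Matrix {e : Finset (Fin n) // e.card = 2} {e : Finset (Fin n) // e.card = 2} ℝ)
    (hsymm : A.IsSymm)
    (hZ : (∀ e f, e ≠ f → 0 ≤ A e f) ∨ (∀ e f, e ≠ f → A e f ≤ 0))
    (hgraph : ∀ e f, e ≠ f →
      (A e f ≠ 0 ↔ ((e : Finset (Fin n)) ∩ (f : Finset (Fin n))).Nonempty))
    (x : {e : Finset (Fin n) // e.card = 2} → ℝ)
    (hx : A.mulVec x = 0)
    (hS : ∀ e : {e : Finset (Fin n) // e.card = 2},
      ¬((∃ j : Fin n, (j : ℕ) + 1 ≤ n - 3 ∧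
            (e : Finset (Fin n)) = {j, (⟨n - 1, by omega⟩ : Fin n)}) ∨
        (e : Finset (Fin n)) = {(⟨n - 3, by omega⟩ : Fin n), (⟨n - 2, by omega⟩ : Fin n)} ∨
        (e : Finset (Fin n)) = {(⟨n - 3, by omega⟩ : Fin n), (⟨n - 1, by omega⟩ : Fin n)} ∨
        (e : Finset (Fin n)) = {(⟨n - 2, by omega⟩ : Fin n), (⟨n - 1, by omega⟩ : Fin n)}) →
      x e = 0) :
    x = 0 := by
  refine eq_zero_of_support_subset_star_union_edge hZ hgraph hx
    (a := ⟨n - 3, by omega⟩) (b := ⟨n - 2, by omega⟩) (c := ⟨n - 1, by omega⟩)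
    (by simp; omega) (by simp; omega) (by simp; omega) hn fun e hxe => ?_
  rcases not_not.mp (mt (hS e) hxe) with ⟨j, -, he⟩ | he | he | he
  · exact Or.inl (by simp [he])
  · exact Or.inr he
  · exact Or.inl (by simp [he])
  · exact Or.inl (by simp [he])
end

section
/- For every n ≥ 6, every symmetric real matrix A in the class 𝒵 whose graph is L(K_n), the line graph of the complete graph on n vertices, has nullity at most C(n,2) − n (where C(n,2) = n(n−1)/2 is the number of vertices of L(K_n)). -/
/-- If two reals with same-sign nonzero weights cancel, they have opposite signs. -/
lemma sign_eq_neg_sign_of_mul_add_mul_eq_zero {a b p q : ℝ} (hab : 0 < a * b)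
    (h : a * p + b * q = 0) : SignType.sign p = -SignType.sign q := by
  have hq : a ^ 2 * p = -(a * b * q) := by linear_combination a * h
  have ha : 0 < a ^ 2 := by
    have : a ≠ 0 := by rintro rfl; simp at hab
    positivity
  have := congrArg SignType.sign hq
  simpa [sign_mul, sign_pos ha, sign_pos hab, Left.sign_neg] using this

/-- Three pairwise opposite signs all vanish. -/
lemma eq_zero_of_pairwise_sign_eq_neg {p q r : ℝ}
    (hpq : SignType.sign p = -SignType.sign q) (hqr : SignType.sign q = -SignType.sign r)
    (hpr : SignType.sign p = -SignType.sign r) : p = 0 ∧ q = 0 ∧ r = 0 := by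
  rw [← sign_eq_zero_iff (a := p), ← sign_eq_zero_iff (a := q), ← sign_eq_zero_iff (a := r)]
  generalize SignType.sign p = s at *
  generalize SignType.sign q = t at *
  generalize SignType.sign r = w at *
  revert s t w
  decide

/-- A row of `A` killing `x` in which only two terms survive, with same-sign coefficients,
forces the two corresponding entries of `x` to have opposite signs. -/
lemma sign_eq_neg_sign_of_mulVec_eq_zero_s9 {ι : Type*} [Fintype ι]
    {A : Matrix ι ι ℝ} {x : ι → ℝ} {e p q : ι} (hx : A.mulVec x e = 0) (hpq : p ≠ q)
    (hpos : 0 < A e p * A e q) (h : ∀ f, f ≠ p → f ≠ q → A e f ≠ 0 → x f = 0) :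
    SignType.sign (x p) = -SignType.sign (x q) := by
  classical
  refine sign_eq_neg_sign_of_mul_add_mul_eq_zero hpos ?_
  rw [← hx, Matrix.mulVec, dotProduct, ← Finset.sum_pair (f := fun f => A e f * x f) hpq]
  refine Finset.sum_subset (Finset.subset_univ _) fun f _ hf => ?_
  simp only [Finset.mem_insert, Finset.mem_singleton, not_or] at hf
  by_cases hA : A e f = 0
  · simp [hA]
  · simp [h f hf.1 hf.2 hA]

/-- A two-element finset is determined by any two distinct members. -/
lemma Finset.eq_pair_of_mem_of_card_eq_two {V : Type*} [DecidableEq V] {s : Finset V}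
    (hs : s.card = 2) {u v : V} (huv : u ≠ v) (hu : u ∈ s) (hv : v ∈ s) : s = {u, v} := by
  refine (Finset.eq_of_subset_of_card_le ?_ ?_).symm
  · simp [Finset.insert_subset_iff, hu, hv]
  · rw [hs, Finset.card_pair huv]

/-- A kernel vector of `A` supported on the star at `c` together with the edge `ab` vanishes,
provided there are three vertices `u, v, w` besides `a, b, c`. -/
lemma eq_zero_of_mulVec_eq_zero_of_support_subset_star {V : Type*} [Fintype V] [DecidableEq V]
    {A : Matrix {e : Finset V // e.card = 2} {e : Finset V // e.card = 2} ℝ}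
    (hpos : ∀ e f g, e ≠ f → e ≠ g → (e.1 ∩ f.1).Nonempty → (e.1 ∩ g.1).Nonempty →
      0 < A e f * A e g)
    (hzero : ∀ e f, e ≠ f → A e f ≠ 0 → (e.1 ∩ f.1).Nonempty)
    {x : {e : Finset V // e.card = 2} → ℝ} (hx : A.mulVec x = 0)
    {a b c : V} (hab : a ≠ b) (hac : a ≠ c) (hbc : b ≠ c)
    (hcard : 6 ≤ Fintype.card V)
    (hsupp : ∀ e, c ∉ e.1 → e.1 ≠ {a, b} → x e = 0) : x = 0 := by
  have key : ∀ (u v c : V) (huv : u ≠ v) (huc : u ≠ c) (hvc : v ≠ c),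
      (∀ f, f.1 ≠ {u, c} → f.1 ≠ {v, c} → u ∈ f.1 ∨ v ∈ f.1 → x f = 0) →
      SignType.sign (x ⟨{u, c}, Finset.card_pair huc⟩) =
        -SignType.sign (x ⟨{v, c}, Finset.card_pair hvc⟩) := by
    intro u v c huv huc hvc h
    have h1 : ({u, v} : Finset V) ≠ {u, c} := by
      intro h; have := Finset.ext_iff.1 h v; simp at this; grind
    have h2 : ({u, v} : Finset V) ≠ {v, c} := by
      intro h; have := Finset.ext_iff.1 h u; simp at this; grind
    have h3 : ({u, c} : Finset V) ≠ {v, c} := by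
      intro h; have := Finset.ext_iff.1 h u; simp at this; grind
    refine sign_eq_neg_sign_of_mulVec_eq_zero_s9 (e := ⟨{u, v}, Finset.card_pair huv⟩)
      (congrFun hx _) (by simpa using h3) (hpos _ _ _ (by simpa using h1) (by simpa using h2)
        ⟨u, by simp⟩ ⟨v, by simp⟩) ?_
    intro f hfu hfv hA
    by_cases hf : (⟨{u, v}, Finset.card_pair huv⟩ : {e : Finset V // e.card = 2}) = f
    · subst hf
      exact h _ h1 h2 (by simp)
    · obtain ⟨z, hz⟩ := hzero _ _ hf hA
      refine h f (fun h => hfu (Subtype.ext h)) (fun h => hfv (Subtype.ext h)) ?_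
      simp at hz
      grind
  have exists_outside : ∀ s : Finset V, s.card ≤ 4 → ∃ v ∉ s, ∃ w ∉ s, v ≠ w := by
    intro s hs
    have h1 : 1 < sᶜ.card := by rw [Finset.card_compl]; omega
    obtain ⟨v, hv, w, hw, hvw⟩ := Finset.one_lt_card.1 h1
    exact ⟨v, by simpa using hv, w, by simpa using hw, hvw⟩
  have hstar : ∀ u (huc : u ≠ c), u ≠ a → u ≠ b → x ⟨{u, c}, Finset.card_pair huc⟩ = 0 := by
    intro u huc hua hub
    obtain ⟨v, hv, w, hw, hvw⟩ := exists_outside {a, b, c, u} Finset.card_le_four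
    simp only [Finset.mem_insert, Finset.mem_singleton, not_or] at hv hw
    have key' : ∀ (u v : V) (huv : u ≠ v) (huc : u ≠ c) (hvc : v ≠ c), u ≠ a → u ≠ b → v ≠ a →
        v ≠ b → SignType.sign (x ⟨{u, c}, Finset.card_pair huc⟩) =
          -SignType.sign (x ⟨{v, c}, Finset.card_pair hvc⟩) := by
      intro u v huv huc hvc hua hub hva hvb
      refine key u v c huv huc hvc fun f hfu hfv hf => hsupp f (fun hc => ?_) (fun h => ?_)
      · rcases hf with hf | hf
        · exact hfu (Finset.eq_pair_of_mem_of_card_eq_two f.2 huc hf hc)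
        · exact hfv (Finset.eq_pair_of_mem_of_card_eq_two f.2 hvc hf hc)
      · simp [h] at hf
        grind
    exact And.left <| eq_zero_of_pairwise_sign_eq_neg
      (key' u v (Ne.symm hv.2.2.2) huc hv.2.2.1 hua hub hv.1 hv.2.1)
      (key' v w hvw hv.2.2.1 hw.2.2.1 hv.1 hv.2.1 hw.1 hw.2.1)
      (key' u w (Ne.symm hw.2.2.2) huc hw.2.2.1 hua hub hw.1 hw.2.1)
  have htri : ∀ f, f.1 ≠ {a, b} → f.1 ≠ {a, c} → f.1 ≠ {b, c} → x f = 0 := by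
    intro f hfab hfac hfbc
    by_cases hc : c ∈ f.1
    · obtain ⟨u, hu, huc⟩ := Finset.exists_mem_ne (by rw [f.2]; norm_num) c
      have hf := Finset.eq_pair_of_mem_of_card_eq_two f.2 huc hu hc
      have : f = ⟨{u, c}, Finset.card_pair huc⟩ := Subtype.ext hf
      rw [this]
      exact hstar u huc (by rintro rfl; exact hfac hf) (by rintro rfl; exact hfbc hf)
    · exact hsupp f hc hfab
  obtain ⟨w, hw, -⟩ := exists_outside {a, b, c} (Finset.card_le_three.trans (by norm_num))
  simp only [Finset.mem_insert, Finset.mem_singleton, not_or] at hw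
  have corner : ∀ (p q r : V) (hpq : p ≠ q) (hpr : p ≠ r), q ≠ r → w ≠ p → w ≠ q → w ≠ r →
      (∀ f, f.1 ≠ {p, q} → f.1 ≠ {p, r} → f.1 ≠ {q, r} → x f = 0) →
      SignType.sign (x ⟨{p, q}, Finset.card_pair hpq⟩) =
        -SignType.sign (x ⟨{p, r}, Finset.card_pair hpr⟩) := by
    intro p q r hpq hpr hqr hwp hwq hwr h
    have h1 : ({p, w} : Finset V) ≠ {p, q} := by
      intro h; have := Finset.ext_iff.1 h w; simp at this; grind
    have h2 : ({p, w} : Finset V) ≠ {p, r} := by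
      intro h; have := Finset.ext_iff.1 h w; simp at this; grind
    have h3 : ({p, q} : Finset V) ≠ {p, r} := by
      intro h; have := Finset.ext_iff.1 h q; simp at this; grind
    have h4 : ({p, w} : Finset V) ≠ {q, r} := by
      intro h; have := Finset.ext_iff.1 h w; simp at this; grind
    refine sign_eq_neg_sign_of_mulVec_eq_zero_s9 (e := ⟨{p, w}, Finset.card_pair hwp.symm⟩)
      (congrFun hx _) (by simpa using h3) (hpos _ _ _ (by simpa using h1) (by simpa using h2)
        ⟨p, by simp⟩ ⟨p, by simp⟩) ?_
    intro f hfq hfr hA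
    refine h f (fun h => hfq (Subtype.ext h)) (fun h => hfr (Subtype.ext h)) fun hf => ?_
    obtain ⟨z, hz⟩ := hzero _ _ (fun h => h4 (by rw [← hf, ← h])) hA
    simp [hf] at hz
    grind
  have hA := corner a b c hab hac hbc hw.1 hw.2.1 hw.2.2 htri
  have hB := corner b a c hab.symm hbc hac hw.2.1 hw.1 hw.2.2 fun f h1 h2 h3 =>
    htri f (by rwa [Finset.pair_comm]) h3 h2
  have hC := corner c a b hac.symm hbc.symm hab hw.2.2 hw.1 hw.2.1 fun f h1 h2 h3 =>
    htri f h3 (by rwa [Finset.pair_comm]) (by rwa [Finset.pair_comm])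
  simp only [Finset.pair_comm b a, Finset.pair_comm c a, Finset.pair_comm c b] at hB hC
  obtain ⟨hxab, hxac, hxbc⟩ := eq_zero_of_pairwise_sign_eq_neg hA hC hB
  funext f
  by_cases h1 : f.1 = {a, b}
  · rw [show f = ⟨{a, b}, Finset.card_pair hab⟩ from Subtype.ext h1, hxab, Pi.zero_apply]
  by_cases h2 : f.1 = {a, c}
  · rw [show f = ⟨{a, c}, Finset.card_pair hac⟩ from Subtype.ext h2, hxac, Pi.zero_apply]
  by_cases h3 : f.1 = {b, c}
  · rw [show f = ⟨{b, c}, Finset.card_pair hbc⟩ from Subtype.ext h3, hxbc, Pi.zero_apply]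
  exact htri f h1 h2 h3

/-- At most `C(n, 2) - n` edges of a complete graph avoid the star at `c` and an edge `ab`
outside it. -/
lemma card_avoiding_star_le {V : Type*} [Fintype V] [DecidableEq V] {a b c : V}
    (hab : a ≠ b) (hac : a ≠ c) (hbc : b ≠ c) :
    Fintype.card {e : {e : Finset V // e.card = 2} // ¬ (c ∈ e.1 ∨ e.1 = {a, b})} ≤
      (Fintype.card V).choose 2 - Fintype.card V := by
  rw [Fintype.card_subtype_compl, Fintype.card_finset_len]
  refine Nat.sub_le_sub_left ?_ _
  let g : V → {e : {e : Finset V // e.card = 2} // c ∈ e.1 ∨ e.1 = {a, b}} := fun u =>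
    if h : u = c then ⟨⟨{a, b}, Finset.card_pair hab⟩, by simp⟩
    else ⟨⟨{u, c}, Finset.card_pair h⟩, by simp⟩
  refine Fintype.card_le_of_injective g fun u v huv => ?_
  have hmem : ∀ z, z ∈ (g u).1.1 ↔ z ∈ (g v).1.1 := fun z => by rw [huv]
  have hu := hmem u
  have hv := hmem v
  have hc := hmem c
  by_cases h1 : u = c <;> by_cases h2 : v = c <;> simp [g, h1, h2] at hu hv hc <;> grind


/-- For every `n ≥ 6`, every symmetric real matrix in the class 𝒵 whose graph is
`L(K_n)` has nullity at most `C(n,2) − n`. -/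
theorem nullity_le_of_Z_matrix_graph_lineGraph_clique
    (n : ℕ) (hn : 6 ≤ n)
    (A : Matrix {e : Finset (Fin n) // e.card = 2} {e : Finset (Fin n) // e.card = 2} ℝ)
    (hsymm : A.IsSymm)
    (hZ : (∀ e f, e ≠ f → 0 ≤ A e f) ∨ (∀ e f, e ≠ f → A e f ≤ 0))
    (hgraph : ∀ e f, e ≠ f →
      (A e f ≠ 0 ↔ ((e : Finset (Fin n)) ∩ (f : Finset (Fin n))).Nonempty)) :
    Module.finrank ℝ (LinearMap.ker A.mulVecLin) ≤ n.choose 2 - n := by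
  have hsame : ∀ e f g, e ≠ f → e ≠ g → (e.1 ∩ f.1).Nonempty → (e.1 ∩ g.1).Nonempty →
      0 < A e f * A e g := by
    intro e f g hef heg hf hg
    have hf' := (hgraph e f hef).2 hf
    have hg' := (hgraph e g heg).2 hg
    rcases hZ with hZ | hZ
    · exact mul_pos (lt_of_le_of_ne (hZ e f hef) hf'.symm) (lt_of_le_of_ne (hZ e g heg) hg'.symm)
    · exact mul_pos_of_neg_of_neg (lt_of_le_of_ne (hZ e f hef) hf')
        (lt_of_le_of_ne (hZ e g heg) hg')
  let a : Fin n := ⟨1, by omega⟩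
  let b : Fin n := ⟨2, by omega⟩
  let c : Fin n := ⟨0, by omega⟩
  have hab : a ≠ b := by simp [a, b]
  have hac : a ≠ c := by simp [a, c]
  have hbc : b ≠ c := by simp [b, c]
  let S := {e : {e : Finset (Fin n) // e.card = 2} // ¬ (c ∈ e.1 ∨ e.1 = {a, b})}
  let restrict : LinearMap.ker A.mulVecLin →ₗ[ℝ] S → ℝ :=
    (LinearMap.funLeft ℝ ℝ Subtype.val).comp (LinearMap.ker A.mulVecLin).subtype
  have hinj : Function.Injective restrict := by
    rw [← LinearMap.ker_eq_bot, LinearMap.ker_eq_bot']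
    rintro ⟨x, hx⟩ hres
    refine Subtype.ext ?_
    refine eq_zero_of_mulVec_eq_zero_of_support_subset_star hsame
      (fun e f hef => (hgraph e f hef).1) (by simpa using hx) hab hac hbc (by simpa using hn) ?_
    intro e hec heab
    exact congrFun hres ⟨e, by simp [hec, heab]⟩
  refine (LinearMap.finrank_le_finrank_of_injective hinj).trans ?_
  rw [Module.finrank_fintype_fun_eq_card]
  simpa only [Fintype.card_fin] using card_avoiding_star_le hab hac hbc
end

section
/- For every n ≥ 6, the maximum nullity of a symmetric real matrix in the class 𝒵 whose graph is L(K_n), the line graph of the complete graph on n vertices, equals C(n,2) − n: every such matrix has nullity at most C(n,2) − n, and there exists such a matrix whose nullity equals C(n,2) − n. -/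
open Finset Module

/-- The entries `a, b` cancel in some combination with weights of the same strict sign. -/
def SignBalanced (a b : ℝ) : Prop :=
  ∃ s t : ℝ, 0 < s * t ∧ s * a + t * b = 0

lemma SignBalanced.mul_nonpos {a b : ℝ} (h : SignBalanced a b) : a * b ≤ 0 := by
  obtain ⟨s, t, hst, h⟩ := h
  have hb : (s * t) * (a * b) = -(t * b) ^ 2 := by linear_combination t * b * h
  by_contra! hab
  nlinarith [mul_pos hst hab, sq_nonneg (t * b)]

lemma SignBalanced.eq_zero {a b : ℝ} (h : SignBalanced a b) (hb : b = 0) : a = 0 := by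
  obtain ⟨s, t, hst, h⟩ := h
  have hs : s ≠ 0 := by rintro rfl; simp at hst
  simpa [hb, hs] using h

/-- Three pairwise balanced reals vanish: two of them would have the same sign. -/
lemma SignBalanced.eq_zero_of_triple {a b c : ℝ} (hab : SignBalanced a b) (hac : SignBalanced a c)
    (hbc : SignBalanced b c) : a = 0 := by
  by_contra ha
  have hb : b ≠ 0 := fun h => ha (hab.eq_zero h)
  have hc : c ≠ 0 := fun h => ha (hac.eq_zero h)
  have h1 := lt_of_le_of_ne hab.mul_nonpos (mul_ne_zero ha hb)
  have h2 := lt_of_le_of_ne hac.mul_nonpos (mul_ne_zero ha hc)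
  have h3 : 0 < a * b * (a * c) := mul_pos_of_neg_of_neg h1 h2
  have h4 : a * b * (a * c) = a ^ 2 * (b * c) := by ring
  nlinarith [hbc.mul_nonpos, sq_nonneg a]

/-- The vertex `{i, j}` of the line graph of the complete graph. -/
def lineVertex {n : ℕ} (i j : Fin n) (h : i ≠ j) : {e : Finset (Fin n) // e.card = 2} :=
  ⟨{i, j}, card_pair h⟩

lemma exists_eq_lineVertex {n : ℕ} (e : {e : Finset (Fin n) // e.card = 2}) :
    ∃ i j, ∃ h : i ≠ j, e = lineVertex i j h := by
  obtain ⟨i, j, h, he⟩ := card_eq_two.mp e.2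
  exact ⟨i, j, h, Subtype.ext he⟩

lemma lineVertex_eq_iff {n : ℕ} {i j k l : Fin n} (h : i ≠ j) (h' : k ≠ l) :
    lineVertex i j h = lineVertex k l h' ↔ i = k ∧ j = l ∨ i = l ∧ j = k := by
  rw [lineVertex, lineVertex, Subtype.mk.injEq, ← coe_inj, coe_pair, coe_pair, Set.pair_eq_pair_iff]

lemma lineVertex_comm {n : ℕ} {i j : Fin n} (h : i ≠ j) :
    lineVertex i j h = lineVertex j i h.symm :=
  (lineVertex_eq_iff h h.symm).2 (Or.inr ⟨rfl, rfl⟩)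

lemma lineVertex_inter_nonempty {n : ℕ} {i j k l : Fin n} (h : i ≠ j) (h' : k ≠ l) :
    ((lineVertex i j h : Finset (Fin n)) ∩ (lineVertex k l h' : Finset (Fin n))).Nonempty ↔
      i = k ∨ i = l ∨ j = k ∨ j = l := by
  simp only [lineVertex, Finset.Nonempty, mem_inter, mem_insert, mem_singleton]
  constructor
  · rintro ⟨x, rfl | rfl, h⟩ <;> tauto
  · rintro (rfl | rfl | rfl | rfl)
    exacts [⟨i, by simp⟩, ⟨i, by simp⟩, ⟨j, by simp⟩, ⟨j, by simp⟩]

/-- If the edges `p, q` meet an edge `r` and a kernel vector vanishes at all other edges meeting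
`r`, then it is balanced at `p, q`. -/
lemma signBalanced_of_mulVec_eq_zero {n : ℕ}
    {A : Matrix {e : Finset (Fin n) // e.card = 2} {e : Finset (Fin n) // e.card = 2} ℝ}
    (hsign : (∀ e f, e ≠ f → 0 ≤ A e f) ∨ (∀ e f, e ≠ f → A e f ≤ 0))
    (hgraph : ∀ e f, e ≠ f →
        (A e f ≠ 0 ↔ ((e : Finset (Fin n)) ∩ (f : Finset (Fin n))).Nonempty))
    {x : {e : Finset (Fin n) // e.card = 2} → ℝ} (hx : A.mulVec x = 0)
    (r : {e : Finset (Fin n) // e.card = 2}) {p q : {e : Finset (Fin n) // e.card = 2}}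
    (hpq : p ≠ q) (hrp : r ≠ p) (hrq : r ≠ q)
    (hp : ((r : Finset (Fin n)) ∩ (p : Finset (Fin n))).Nonempty)
    (hq : ((r : Finset (Fin n)) ∩ (q : Finset (Fin n))).Nonempty)
    (h : ∀ f, f ≠ p → f ≠ q → ((r : Finset (Fin n)) ∩ (f : Finset (Fin n))).Nonempty → x f = 0) :
    SignBalanced (x p) (x q) := by
  have hp0 := (hgraph r p hrp).2 hp
  have hq0 := (hgraph r q hrq).2 hq
  refine ⟨A r p, A r q, ?_, ?_⟩
  · rcases hsign with h | h
    · exact mul_pos ((h r p hrp).lt_of_ne hp0.symm) ((h r q hrq).lt_of_ne hq0.symm)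
    · exact mul_pos_of_neg_of_neg ((h r p hrp).lt_of_ne hp0) ((h r q hrq).lt_of_ne hq0)
  · have hr := congrFun hx r
    rw [Matrix.mulVec, dotProduct, Fintype.sum_eq_add p q hpq] at hr
    · exact hr
    · rintro f ⟨hfp, hfq⟩
      by_cases hf : ((r : Finset (Fin n)) ∩ (f : Finset (Fin n))).Nonempty
      · rw [h f hfp hfq hf, mul_zero]
      · have hrf : r ≠ f := by
          rintro rfl
          rw [inter_self, ← card_pos, r.2] at hf
          omega
        rw [not_ne_iff.1 fun h0 => hf ((hgraph r f hrf).1 h0), zero_mul]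

/-- A kernel vector supported on a triangle is balanced at any two edges of the triangle. -/
lemma signBalanced_of_supported_triangle {n : ℕ}
    {A : Matrix {e : Finset (Fin n) // e.card = 2} {e : Finset (Fin n) // e.card = 2} ℝ}
    (hsign : (∀ e f, e ≠ f → 0 ≤ A e f) ∨ (∀ e f, e ≠ f → A e f ≤ 0))
    (hgraph : ∀ e f, e ≠ f →
        (A e f ≠ 0 ↔ ((e : Finset (Fin n)) ∩ (f : Finset (Fin n))).Nonempty))
    {x : {e : Finset (Fin n) // e.card = 2} → ℝ} (hx : A.mulVec x = 0)
    {u v w d : Fin n} (huv : u ≠ v) (huw : u ≠ w) (hvw : v ≠ w)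
    (hdu : d ≠ u) (hdv : d ≠ v) (hdw : d ≠ w)
    (hsupp : ∀ i j (h : i ≠ j), ¬ ((i = u ∨ i = v ∨ i = w) ∧ (j = u ∨ j = v ∨ j = w)) →
      x (lineVertex i j h) = 0) :
    SignBalanced (x (lineVertex u v huv)) (x (lineVertex u w huw)) := by
  refine signBalanced_of_mulVec_eq_zero hsign hgraph hx (lineVertex d u hdu) ?_ ?_ ?_ ?_ ?_ ?_
  · rw [Ne, lineVertex_eq_iff]; tauto
  · rw [Ne, lineVertex_eq_iff]; tauto
  · rw [Ne, lineVertex_eq_iff]; tauto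
  · rw [lineVertex_inter_nonempty]; tauto
  · rw [lineVertex_inter_nonempty]; tauto
  · intro f hfv hfw hf
    obtain ⟨i, j, hij, rfl⟩ := exists_eq_lineVertex f
    rw [Ne, lineVertex_eq_iff] at hfv hfw
    rw [lineVertex_inter_nonempty] at hf
    apply hsupp
    grind

/-- A kernel vector supported on a triangle vanishes at every edge of the triangle. -/
lemma eq_zero_of_supported_triangle {n : ℕ}
    {A : Matrix {e : Finset (Fin n) // e.card = 2} {e : Finset (Fin n) // e.card = 2} ℝ}
    (hsign : (∀ e f, e ≠ f → 0 ≤ A e f) ∨ (∀ e f, e ≠ f → A e f ≤ 0))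
    (hgraph : ∀ e f, e ≠ f →
        (A e f ≠ 0 ↔ ((e : Finset (Fin n)) ∩ (f : Finset (Fin n))).Nonempty))
    {x : {e : Finset (Fin n) // e.card = 2} → ℝ} (hx : A.mulVec x = 0)
    {u v w d : Fin n} (huv : u ≠ v) (huw : u ≠ w) (hvw : v ≠ w)
    (hdu : d ≠ u) (hdv : d ≠ v) (hdw : d ≠ w)
    (hsupp : ∀ i j (h : i ≠ j), ¬ ((i = u ∨ i = v ∨ i = w) ∧ (j = u ∨ j = v ∨ j = w)) →
      x (lineVertex i j h) = 0) :
    x (lineVertex u v huv) = 0 := by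
  have h₁ := signBalanced_of_supported_triangle hsign hgraph hx huv huw hvw hdu hdv hdw hsupp
  have h₂ := signBalanced_of_supported_triangle hsign hgraph hx huv.symm hvw huw hdv hdu hdw
    fun i j h hij => hsupp i j h (by tauto)
  have h₃ := signBalanced_of_supported_triangle hsign hgraph hx huw.symm hvw.symm huv hdw hdu hdv
    fun i j h hij => hsupp i j h (by tauto)
  rw [lineVertex_comm huv.symm] at h₂
  rw [lineVertex_comm huw.symm, lineVertex_comm hvw.symm] at h₃
  exact h₁.eq_zero_of_triple h₂ h₃

/-- A kernel vector supported on the star at `a` together with the edge `{b, c}` is balanced at any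
two edges of the star avoiding `b` and `c`. -/
lemma signBalanced_of_supported_star {n : ℕ}
    {A : Matrix {e : Finset (Fin n) // e.card = 2} {e : Finset (Fin n) // e.card = 2} ℝ}
    (hsign : (∀ e f, e ≠ f → 0 ≤ A e f) ∨ (∀ e f, e ≠ f → A e f ≤ 0))
    (hgraph : ∀ e f, e ≠ f →
        (A e f ≠ 0 ↔ ((e : Finset (Fin n)) ∩ (f : Finset (Fin n))).Nonempty))
    {x : {e : Finset (Fin n) // e.card = 2} → ℝ} (hx : A.mulVec x = 0)
    {a b c j k : Fin n}
    (hsupp : ∀ u v (h : u ≠ v), u ≠ a → v ≠ a → ¬ (u = b ∧ v = c ∨ u = c ∧ v = b) →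
      x (lineVertex u v h) = 0)
    (hj : a ≠ j) (hk : a ≠ k) (hjk : j ≠ k) (hjb : j ≠ b) (hjc : j ≠ c) (hkb : k ≠ b)
    (hkc : k ≠ c) : SignBalanced (x (lineVertex a j hj)) (x (lineVertex a k hk)) := by
  refine signBalanced_of_mulVec_eq_zero hsign hgraph hx (lineVertex j k hjk) ?_ ?_ ?_ ?_ ?_ ?_
  · rw [Ne, lineVertex_eq_iff]; tauto
  · rw [Ne, lineVertex_eq_iff]; tauto
  · rw [Ne, lineVertex_eq_iff]; tauto
  · rw [lineVertex_inter_nonempty]; tauto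
  · rw [lineVertex_inter_nonempty]; tauto
  · intro f hfj hfk hf
    obtain ⟨u, v, huv, rfl⟩ := exists_eq_lineVertex f
    rw [Ne, lineVertex_eq_iff] at hfj hfk
    rw [lineVertex_inter_nonempty] at hf
    apply hsupp <;> grind

/-- A kernel vector of a matrix of class `𝒵` with graph `L(K_n)`, supported on the star at `a`
together with the edge `{b, c}`, vanishes. -/
lemma eq_zero_of_supported_star {n : ℕ} (hn : 6 ≤ n)
    {A : Matrix {e : Finset (Fin n) // e.card = 2} {e : Finset (Fin n) // e.card = 2} ℝ}
    (hsign : (∀ e f, e ≠ f → 0 ≤ A e f) ∨ (∀ e f, e ≠ f → A e f ≤ 0))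
    (hgraph : ∀ e f, e ≠ f →
        (A e f ≠ 0 ↔ ((e : Finset (Fin n)) ∩ (f : Finset (Fin n))).Nonempty))
    {x : {e : Finset (Fin n) // e.card = 2} → ℝ} (hx : A.mulVec x = 0)
    {a b c : Fin n} (hab : a ≠ b) (hac : a ≠ c) (hbc : b ≠ c)
    (hsupp : ∀ u v (h : u ≠ v), u ≠ a → v ≠ a → ¬ (u = b ∧ v = c ∨ u = c ∧ v = b) →
      x (lineVertex u v h) = 0) : x = 0 := by
  have hfresh : ∀ s : Finset (Fin n), s.card ≤ 5 → ∃ j, j ∉ s := by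
    intro s hs
    by_contra! h
    have := card_le_card (fun j _ => h j : (univ : Finset (Fin n)) ⊆ s)
    simp at this
    omega
  have hleaf : ∀ j (hj : a ≠ j), j ≠ b → j ≠ c → x (lineVertex a j hj) = 0 := by
    intro j hj hjb hjc
    obtain ⟨k, hk⟩ := hfresh {a, b, c, j} (card_le_four.trans (by norm_num))
    obtain ⟨l, hl⟩ := hfresh {a, b, c, j, k} card_le_five
    simp only [mem_insert, mem_singleton, not_or] at hk hl
    obtain ⟨hka, hkb, hkc, hkj⟩ := hk
    obtain ⟨hla, hlb, hlc, hlj, hlk⟩ := hl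
    have hpair := @signBalanced_of_supported_star n A hsign hgraph x hx a b c
    exact (hpair hsupp hj (Ne.symm hka) (Ne.symm hkj) hjb hjc hkb hkc).eq_zero_of_triple
      (hpair hsupp hj (Ne.symm hla) (Ne.symm hlj) hjb hjc hlb hlc)
      (hpair hsupp (Ne.symm hka) (Ne.symm hla) (Ne.symm hlk) hkb hkc hlb hlc)
  have htri : ∀ i j (h : i ≠ j),
      ¬ ((i = a ∨ i = b ∨ i = c) ∧ (j = a ∨ j = b ∨ j = c)) → x (lineVertex i j h) = 0 := by
    intro i j h hij
    by_cases hi : i = a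
    · subst hi
      exact hleaf j h (by tauto) (by tauto)
    · by_cases hj : j = a
      · subst hj
        rw [lineVertex_comm]
        exact hleaf i h.symm (by tauto) (by tauto)
      · exact hsupp i j h hi hj (by tauto)
  obtain ⟨d, hd⟩ := hfresh {a, b, c} (card_le_three.trans (by norm_num))
  simp only [mem_insert, mem_singleton, not_or] at hd
  obtain ⟨hda, hdb, hdc⟩ := hd
  have hxab := eq_zero_of_supported_triangle hsign hgraph hx hab hac hbc hda hdb hdc htri
  have hxac := eq_zero_of_supported_triangle hsign hgraph hx hac hab hbc.symm hda hdc hdb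
    fun i j h hij => htri i j h (by tauto)
  have hxbc := eq_zero_of_supported_triangle hsign hgraph hx hbc hab.symm hac.symm hdb hdc hda
    fun i j h hij => htri i j h (by tauto)
  funext f
  obtain ⟨i, j, hij, rfl⟩ := exists_eq_lineVertex f
  by_cases hS : (i = a ∨ i = b ∨ i = c) ∧ (j = a ∨ j = b ∨ j = c)
  · obtain ⟨rfl | rfl | rfl, rfl | rfl | rfl⟩ := hS
    all_goals first
      | exact absurd rfl hij
      | assumption
      | (rw [lineVertex_comm]; assumption)
  · exact htri i j hij hS

lemma card_edges_avoiding {n : ℕ} (a : Fin n) (p : {e : Finset (Fin n) // e.card = 2})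
    (hp : a ∉ p.1) :
    Fintype.card {e : {e : Finset (Fin n) // e.card = 2} // a ∉ e.1 ∧ e ≠ p} =
      (n - 1).choose 2 - 1 := by
  have himage : (univ.filter fun e : {e : Finset (Fin n) // e.card = 2} =>
      a ∉ e.1 ∧ e ≠ p).map (Function.Embedding.subtype _) =
      ((univ.erase a).powersetCard 2).erase p.1 := by
    ext e
    simp only [mem_map, mem_filter, mem_univ, true_and, Function.Embedding.subtype_apply,
      mem_erase, mem_powersetCard, subset_erase, subset_univ]
    constructor
    · rintro ⟨e, ⟨h1, h2⟩, rfl⟩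
      exact ⟨fun h => h2 (Subtype.ext h), h1, e.2⟩
    · rintro ⟨h1, h2, h3⟩
      exact ⟨⟨e, h3⟩, ⟨h2, fun h => h1 (congrArg Subtype.val h)⟩, rfl⟩
  rw [Fintype.card_subtype, ← card_map (Function.Embedding.subtype _), himage, card_erase_of_mem,
    card_powersetCard, card_erase_of_mem (mem_univ a), card_univ, Fintype.card_fin]
  rw [mem_powersetCard, subset_erase]
  exact ⟨⟨subset_univ _, hp⟩, p.2⟩

lemma finrank_ker_le_of_lineGraph {n : ℕ} (hn : 6 ≤ n)
    {A : Matrix {e : Finset (Fin n) // e.card = 2} {e : Finset (Fin n) // e.card = 2} ℝ}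
    (hsign : (∀ e f, e ≠ f → 0 ≤ A e f) ∨ (∀ e f, e ≠ f → A e f ≤ 0))
    (hgraph : ∀ e f, e ≠ f →
        (A e f ≠ 0 ↔ ((e : Finset (Fin n)) ∩ (f : Finset (Fin n))).Nonempty)) :
    finrank ℝ (LinearMap.ker A.mulVecLin) ≤ n.choose 2 - n := by
  let a : Fin n := ⟨0, by omega⟩
  let b : Fin n := ⟨1, by omega⟩
  let c : Fin n := ⟨2, by omega⟩
  have hab : a ≠ b := by simp [a, b]
  have hac : a ≠ c := by simp [a, c]
  have hbc : b ≠ c := by simp [b, c]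
  let S := {e : {e : Finset (Fin n) // e.card = 2} // a ∉ e.1 ∧ e ≠ lineVertex b c hbc}
  let φ : LinearMap.ker A.mulVecLin →ₗ[ℝ] (S → ℝ) :=
    (LinearMap.funLeft ℝ ℝ (Subtype.val : S → _)) ∘ₗ (LinearMap.ker A.mulVecLin).subtype
  have hφ : Function.Injective φ := by
    rw [injective_iff_map_eq_zero]
    rintro ⟨x, hx⟩ h
    refine Subtype.ext (eq_zero_of_supported_star hn hsign hgraph hx hab hac hbc ?_)
    intro i j hij hi hj hne
    exact congrFun h ⟨lineVertex i j hij, by simp [lineVertex, hi.symm, hj.symm], by rwa [Ne, lineVertex_eq_iff]⟩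
  have hle := LinearMap.finrank_le_finrank_of_injective hφ
  rw [finrank_fintype_fun_eq_card,
    card_edges_avoiding a _ (by simp [lineVertex, hab, hac])] at hle
  obtain ⟨m, rfl⟩ : ∃ m, n = m + 1 := ⟨n - 1, by omega⟩
  have : (m + 1).choose 2 = m + m.choose 2 := by
    rw [Nat.choose_succ_succ' m 1, Nat.choose_one_right]
  simp only [Nat.add_sub_cancel] at hle
  omega

/-- The vertex-edge incidence matrix of the complete graph. -/
def cliqueIncidence (n : ℕ) : Matrix (Fin n) {e : Finset (Fin n) // e.card = 2} ℝ :=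
  fun v e => if v ∈ e.1 then 1 else 0

lemma cliqueIncidence_gram_apply (n : ℕ) (e f : {e : Finset (Fin n) // e.card = 2}) :
    ((cliqueIncidence n).transpose * cliqueIncidence n) e f = ((e.1 ∩ f.1).card : ℝ) := by
  simp [Matrix.mul_apply, cliqueIncidence, ← ite_and, ← mem_inter, inter_comm]

lemma card_sub_le_finrank_ker {ι κ : Type*} [Fintype ι] [Fintype κ] [DecidableEq ι]
    (B : Matrix κ ι ℝ) :
    Fintype.card ι - Fintype.card κ ≤
      finrank ℝ (LinearMap.ker (B.transpose * B).mulVecLin) := by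
  have hrank : (B.transpose * B).rank ≤ Fintype.card κ := by
    rw [Matrix.rank_transpose_mul_self]
    exact Matrix.rank_le_card_height B
  have hnull := LinearMap.finrank_range_add_finrank_ker (B.transpose * B).mulVecLin
  rw [finrank_fintype_fun_eq_card] at hnull
  rw [Matrix.rank] at hrank
  omega

/-- For every `n ≥ 6`, the maximum nullity of a symmetric real matrix in the
class 𝒵 whose graph is `L(K_n)` equals `C(n,2) − n`: every such matrix has
nullity at most `C(n,2) − n`, and some such matrix attains this nullity. -/
theorem max_nullity_Z_matrix_lineGraph_clique
    (n : ℕ) (hn : 6 ≤ n) :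
    (∀ A : Matrix {e : Finset (Fin n) // e.card = 2} {e : Finset (Fin n) // e.card = 2} ℝ,
      A.IsSymm →
      ((∀ e f, e ≠ f → 0 ≤ A e f) ∨ (∀ e f, e ≠ f → A e f ≤ 0)) →
      (∀ e f, e ≠ f →
        (A e f ≠ 0 ↔ ((e : Finset (Fin n)) ∩ (f : Finset (Fin n))).Nonempty)) →
      Module.finrank ℝ (LinearMap.ker A.mulVecLin) ≤ n.choose 2 - n) ∧
    (∃ A : Matrix {e : Finset (Fin n) // e.card = 2} {e : Finset (Fin n) // e.card = 2} ℝ,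
      A.IsSymm ∧
      ((∀ e f, e ≠ f → 0 ≤ A e f) ∨ (∀ e f, e ≠ f → A e f ≤ 0)) ∧
      (∀ e f, e ≠ f →
        (A e f ≠ 0 ↔ ((e : Finset (Fin n)) ∩ (f : Finset (Fin n))).Nonempty)) ∧
      Module.finrank ℝ (LinearMap.ker A.mulVecLin) = n.choose 2 - n) := by
  refine ⟨fun A _ hsign hgraph => finrank_ker_le_of_lineGraph hn hsign hgraph,
    (cliqueIncidence n).transpose * cliqueIncidence n, ?_, ?_, ?_, ?_⟩
  · rw [Matrix.IsSymm, Matrix.transpose_mul, Matrix.transpose_transpose]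
  · exact Or.inl fun e f _ => by rw [cliqueIncidence_gram_apply]; positivity
  · intro e f _
    rw [cliqueIncidence_gram_apply, Nat.cast_ne_zero, card_ne_zero]
  · apply le_antisymm
    · refine finrank_ker_le_of_lineGraph hn ?_ ?_
      · exact Or.inl fun e f _ => by rw [cliqueIncidence_gram_apply]; positivity
      · intro e f _
        rw [cliqueIncidence_gram_apply, Nat.cast_ne_zero, card_ne_zero]
    · have h := card_sub_le_finrank_ker (cliqueIncidence n)
      rwa [Fintype.card_finset_len, Fintype.card_fin] at h
end

section
/- Every symmetric real matrix A in the class 𝒵 whose graph is L(K_5), the line graph of the complete graph on 5 vertices (a graph on 10 vertices), has nullity at most 6. -/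
/-- The rank of any square submatrix with nonzero determinant bounds the rank from below. -/
theorem Matrix.card_le_rank_of_det_submatrix_ne_zero {m n k K : Type*} [Field K]
    [Fintype m] [Fintype n] [Fintype k] [DecidableEq k] (A : Matrix m n K)
    (r : k → m) (c : k → n) (h : (A.submatrix r c).det ≠ 0) : Fintype.card k ≤ A.rank := by
  rw [← Matrix.rank_of_isUnit _ ((Matrix.isUnit_iff_isUnit_det _).2 h.isUnit)]
  exact Matrix.rank_submatrix_le A r c

/-- Every symmetric real matrix in the class 𝒵 whose graph is `L(K_5)` (a graph
on 10 vertices) has nullity at most 6. -/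
theorem nullity_le_six_of_Z_matrix_graph_lineGraph_K5
    (A : Matrix {e : Finset (Fin 5) // e.card = 2} {e : Finset (Fin 5) // e.card = 2} ℝ)
    (hsymm : A.IsSymm)
    (hZ : (∀ e f, e ≠ f → 0 ≤ A e f) ∨ (∀ e f, e ≠ f → A e f ≤ 0))
    (hgraph : ∀ e f, e ≠ f →
      (A e f ≠ 0 ↔ ((e : Finset (Fin 5)) ∩ (f : Finset (Fin 5))).Nonempty)) :
    Module.finrank ℝ (LinearMap.ker A.mulVecLin) ≤ 6 := by
  let r : Fin 4 → {e : Finset (Fin 5) // e.card = 2} :=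
    ![⟨{0, 4}, rfl⟩, ⟨{0, 1}, rfl⟩, ⟨{0, 2}, rfl⟩, ⟨{0, 3}, rfl⟩]
  let c : Fin 4 → {e : Finset (Fin 5) // e.card = 2} :=
    ![⟨{0, 1}, rfl⟩, ⟨{1, 2}, rfl⟩, ⟨{1, 3}, rfl⟩, ⟨{2, 3}, rfl⟩]
  have hzero : ∀ i j, r i ≠ c j → ¬ ((r i : Finset (Fin 5)) ∩ c j).Nonempty →
      A (r i) (c j) = 0 := fun i j hne hdisj =>
    not_not.1 fun h => hdisj ((hgraph _ _ hne).1 h)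
  have hdet : (A.submatrix r c).det =
      -((A (r 0) (c 0) * A (r 1) (c 1)) * (A (r 2) (c 3) * A (r 3) (c 2)) +
        (A (r 0) (c 0) * A (r 1) (c 2)) * (A (r 2) (c 1) * A (r 3) (c 3))) := by
    have h01 := hzero 0 1 (by decide) (by decide)
    have h02 := hzero 0 2 (by decide) (by decide)
    have h03 := hzero 0 3 (by decide) (by decide)
    have h13 := hzero 1 3 (by decide) (by decide)
    have h22 := hzero 2 2 (by decide) (by decide)
    have h31 := hzero 3 1 (by decide) (by decide)
    rw [Matrix.det_succ_row_zero]
    simp only [Fin.sum_univ_four, Matrix.det_fin_three, Matrix.submatrix_apply, h01, h02, h03]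
    simp [Fin.succAbove, -Matrix.cons_val]
    rw [h13, h22, h31]
    ring
  have hpos : ∀ i j k l, r i ≠ c j ∧ ((r i : Finset (Fin 5)) ∩ c j).Nonempty →
      r k ≠ c l ∧ ((r k : Finset (Fin 5)) ∩ c l).Nonempty →
      0 < A (r i) (c j) * A (r k) (c l) := by
    rintro i j k l ⟨hij, hij'⟩ ⟨hkl, hkl'⟩
    refine lt_of_le_of_ne ?_
      (mul_ne_zero ((hgraph _ _ hij).2 hij') ((hgraph _ _ hkl).2 hkl')).symm
    rcases hZ with hZ | hZ
    · exact mul_nonneg (hZ _ _ hij) (hZ _ _ hkl)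
    · exact mul_nonneg_of_nonpos_of_nonpos (hZ _ _ hij) (hZ _ _ hkl)
  have hdet0 : (A.submatrix r c).det ≠ 0 := by
    rw [hdet]
    exact (neg_neg_of_pos (add_pos
      (mul_pos (hpos 0 0 1 1 (by decide) (by decide)) (hpos 2 3 3 2 (by decide) (by decide)))
      (mul_pos (hpos 0 0 1 2 (by decide) (by decide)) (hpos 2 1 3 3 (by decide) (by decide))))).ne
  have hrank := A.card_le_rank_of_det_submatrix_ne_zero r c hdet0
  have hcard : Fintype.card {e : Finset (Fin 5) // e.card = 2} = 10 := by decide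
  have hnull := LinearMap.finrank_range_add_finrank_ker A.mulVecLin
  rw [Module.finrank_fintype_fun_eq_card, hcard] at hnull
  rw [Fintype.card_fin, Matrix.rank] at hrank
  omega
end

section
/- Let T be a tree (a connected acyclic simple graph) on a finite vertex set. For every symmetric real matrix A whose graph is T, there exists a symmetric real matrix B in the class 𝒵 whose graph is T and whose nullity equals the nullity of A. Consequently, the maximum nullity of a matrix in 𝒵 whose graph is T equals the maximum nullity over all symmetric real matrices whose graph is T. -/
/-- A gain function on a tree is a coboundary: every edge labelling by a group that inverts under
reversal comes from a potential on the vertices. -/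
theorem SimpleGraph.IsTree.exists_potential {V M : Type*} [Group M] {G : SimpleGraph V}
    (hT : G.IsTree) (f : V → V → M) (hf : ∀ u v, G.Adj u v → f v u = (f u v)⁻¹) :
    ∃ s : V → M, ∀ u v, G.Adj u v → s v = s u * f u v := by
  classical
  obtain ⟨r⟩ := hT.1.nonempty
  let gain {v : V} (p : G.Walk r v) : M := (p.darts.map fun d => f d.fst d.snd).prod
  have gain_concat {u v : V} (p : G.Walk r u) (h : G.Adj u v) :
      gain (p.concat h) = gain p * f u v := by
    simp [gain, SimpleGraph.Walk.darts_concat]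
  choose p hp using fun v => (hT.1 r v).exists_isPath
  have step {u v : V} (h : G.Adj u v) (hv : v ∉ (p u).support) :
      gain (p v) = gain (p u) * f u v := by
    have hq : p v = (p u).concat h :=
      (hT.existsUnique_path r v).unique (hp v) ((hp u).concat hv h)
    rw [hq, gain_concat]
  refine ⟨fun v => gain (p v), fun u v h => ?_⟩
  by_cases hv : v ∈ (p u).support
  · have hu : u ∉ (p v).support := by
      have hq : p v = (p u).takeUntil v hv :=
        (hT.existsUnique_path r v).unique (hp v) ((hp u).takeUntil hv)
      rw [hq]
      exact SimpleGraph.Walk.endpoint_notMem_support_takeUntil (hp u) hv h.ne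
    simp only
    rw [step h.symm hu, hf u v h, inv_mul_cancel_right]
  · exact step h hv

/-- Conjugation by an invertible diagonal matrix preserves the nullity. -/
theorem Matrix.finrank_ker_diagonal_mul_mul_diagonal {V K : Type*} [Fintype V] [DecidableEq V]
    [Field K] (A : Matrix V V K) (s : V → Kˣ) :
    Module.finrank K (LinearMap.ker
        (diagonal (fun v => (s v : K)) * A * diagonal (fun v => (s v : K))).mulVecLin) =
      Module.finrank K (LinearMap.ker A.mulVecLin) := by
  have hs : IsUnit (diagonal fun v => (s v : K)).det := by
    rw [det_diagonal, isUnit_iff_ne_zero]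
    exact Finset.prod_ne_zero_iff.2 fun v _ => (s v).ne_zero
  have hrank := (rank_mul_eq_left_of_isUnit_det _ (diagonal (fun v => (s v : K)) * A) hs).trans
    (rank_mul_eq_right_of_isUnit_det _ A hs)
  simp only [rank] at hrank
  have h₁ := LinearMap.finrank_range_add_finrank_ker A.mulVecLin
  have h₂ := LinearMap.finrank_range_add_finrank_ker
    (diagonal (fun v => (s v : K)) * A * diagonal (fun v => (s v : K))).mulVecLin
  omega

/-- Every symmetric real matrix whose graph is a tree can be made entrywise nonnegative off the
diagonal, without changing its graph or nullity. -/
theorem SimpleGraph.IsTree.exists_nonneg_matrix_finrank_ker_eq {V : Type*} [Fintype V]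
    {G : SimpleGraph V} (hT : G.IsTree) (A : Matrix V V ℝ) (hA : A.IsSymm)
    (hG : ∀ u v, u ≠ v → (A u v ≠ 0 ↔ G.Adj u v)) :
    ∃ B : Matrix V V ℝ, B.IsSymm ∧ (∀ u v, u ≠ v → 0 ≤ B u v) ∧
      (∀ u v, u ≠ v → (B u v ≠ 0 ↔ G.Adj u v)) ∧
      Module.finrank ℝ (LinearMap.ker B.mulVecLin) =
        Module.finrank ℝ (LinearMap.ker A.mulVecLin) := by
  classical
  let f : V → V → ℝˣ := fun u v => if 0 ≤ A u v then 1 else -1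
  obtain ⟨s, hs⟩ := hT.exists_potential f fun u v _ => by
    simp only [f, hA.apply u v]
    split_ifs <;> simp
  refine ⟨Matrix.diagonal (fun v => (s v : ℝ)) * A * Matrix.diagonal (fun v => (s v : ℝ)),
    ?_, fun u v huv => ?_, fun u v huv => ?_, A.finrank_ker_diagonal_mul_mul_diagonal s⟩
  · simp [Matrix.IsSymm, Matrix.transpose_mul, hA.eq, Matrix.mul_assoc]
  · rw [Matrix.mul_diagonal, Matrix.diagonal_mul]
    by_cases h : G.Adj u v
    · have hfA : 0 ≤ (f u v : ℝ) * A u v := by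
        simp only [f]
        split_ifs with h0
        · simpa using h0
        · simpa using (not_le.1 h0).le
      calc (0 : ℝ) ≤ (s u : ℝ) ^ 2 * ((f u v : ℝ) * A u v) := by positivity
        _ = _ := by rw [hs u v h]; push_cast; ring
    · rw [not_not.1 (mt (hG u v huv).1 h)]
      simp
  · rw [Matrix.mul_diagonal, Matrix.diagonal_mul, ← hG u v huv]
    simp


/-- For a tree `T`: every symmetric real matrix whose graph is `T` has the same
nullity as some 𝒵-matrix whose graph is `T`; consequently the maximum nullity
over 𝒵-matrices with graph `T` equals the maximum nullity over all symmetric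
real matrices with graph `T`. -/
theorem tree_max_Z_nullity_eq_max_nullity
    {V : Type*} [Fintype V] (G : SimpleGraph V) (hT : G.IsTree) :
    (∀ A : Matrix V V ℝ, A.IsSymm →
      (∀ u v, u ≠ v → (A u v ≠ 0 ↔ G.Adj u v)) →
      ∃ B : Matrix V V ℝ, B.IsSymm ∧
        ((∀ u v, u ≠ v → 0 ≤ B u v) ∨ (∀ u v, u ≠ v → B u v ≤ 0)) ∧
        (∀ u v, u ≠ v → (B u v ≠ 0 ↔ G.Adj u v)) ∧
        Module.finrank ℝ (LinearMap.ker B.mulVecLin) =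
          Module.finrank ℝ (LinearMap.ker A.mulVecLin)) ∧
    sSup {k : ℕ | ∃ B : Matrix V V ℝ, B.IsSymm ∧
        ((∀ u v, u ≠ v → 0 ≤ B u v) ∨ (∀ u v, u ≠ v → B u v ≤ 0)) ∧
        (∀ u v, u ≠ v → (B u v ≠ 0 ↔ G.Adj u v)) ∧
        Module.finrank ℝ (LinearMap.ker B.mulVecLin) = k} =
      sSup {k : ℕ | ∃ A : Matrix V V ℝ, A.IsSymm ∧
        (∀ u v, u ≠ v → (A u v ≠ 0 ↔ G.Adj u v)) ∧
        Module.finrank ℝ (LinearMap.ker A.mulVecLin) = k} := by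
  refine ⟨fun A hA hG => ?_, ?_⟩
  · obtain ⟨B, hB, hnonneg, hBG, hker⟩ :=
      hT.exists_nonneg_matrix_finrank_ker_eq A hA hG
    exact ⟨B, hB, .inl hnonneg, hBG, hker⟩
  · congr 1
    ext k
    constructor
    · rintro ⟨B, hB, -, hBG, rfl⟩
      exact ⟨B, hB, hBG, rfl⟩
    · rintro ⟨A, hA, hG, rfl⟩
      obtain ⟨B, hB, hnonneg, hBG, hker⟩ :=
        hT.exists_nonneg_matrix_finrank_ker_eq A hA hG
      exact ⟨B, hB, .inl hnonneg, hBG, hker⟩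
end

section
/- Let A be a symmetric real 6×6 matrix (indexed by {1,…,6}) with A₁₂ = A₃₄ = A₅₆ = 0 and with every other off-diagonal entry strictly positive (the diagonal entries are arbitrary). Then the rank of A is at least 3; equivalently, the nullity of A is at most 3. -/
/-- A symmetric real 6×6 matrix with zero entries exactly at the off-diagonal
positions `{1,2}, {3,4}, {5,6}` (0-indexed: `{0,1}, {2,3}, {4,5}`) and all other
off-diagonal entries strictly positive has rank at least 3; equivalently, its
nullity is at most 3. -/
theorem octahedron_rank_ge_three
    (A : Matrix (Fin 6) (Fin 6) ℝ) (hsymm : A.IsSymm)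
    (h12 : A 0 1 = 0) (h34 : A 2 3 = 0) (h56 : A 4 5 = 0)
    (hpos : ∀ i j : Fin 6, i ≠ j →
      ¬((i = 0 ∧ j = 1) ∨ (i = 1 ∧ j = 0) ∨ (i = 2 ∧ j = 3) ∨ (i = 3 ∧ j = 2) ∨
        (i = 4 ∧ j = 5) ∨ (i = 5 ∧ j = 4)) → 0 < A i j) :
    3 ≤ A.rank ∧ Module.finrank ℝ (LinearMap.ker A.mulVecLin) ≤ 3 := by
  have hdet : (A.submatrix ![0, 2, 4] ![1, 3, 5]).det ≠ 0 := by
    have h1 : 0 < A 0 3 * A 2 5 * A 4 1 :=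
      mul_pos (mul_pos (hpos 0 3 (by decide) (by decide)) (hpos 2 5 (by decide) (by decide)))
        (hpos 4 1 (by decide) (by decide))
    have h2 : 0 < A 0 5 * A 2 1 * A 4 3 :=
      mul_pos (mul_pos (hpos 0 5 (by decide) (by decide)) (hpos 2 1 (by decide) (by decide)))
        (hpos 4 3 (by decide) (by decide))
    rw [Matrix.det_fin_three]
    simp only [Matrix.submatrix_apply, Matrix.cons_val, h12, h34, h56]
    linarith
  have hrank : 3 ≤ A.rank := by
    simpa only [Matrix.rank_of_det_ne_zero hdet, Fintype.card_fin] using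
      A.rank_submatrix_le ![0, 2, 4] ![1, 3, 5]
  have hnull := A.mulVecLin.finrank_range_add_finrank_ker
  rw [Module.finrank_fin_fun] at hnull
  refine ⟨hrank, ?_⟩
  change 3 ≤ Module.finrank ℝ (LinearMap.range A.mulVecLin) at hrank
  omega
end
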